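/- arXiv:1002.3769 — 2 statements merged into one kernel-verified Lean document; each statement's English description precedes it below -/
import Mathlib

section
/- Let T be a tile system in an arbitrary neighborhood N, with finite set of glues X. There exist a finite glue set X_μ, a tile system T_μ in neighborhood N_vN over X_μ, a scale s ≥ 1, a polyomino assignment φ, and a tiling-simulation ψ of T by T_μ such that for every (T,N)-tiling τ: τ is connected if and only if every poly-tiling in ψ(τ), viewed as a (T_μ,N_vN)-tiling via its induced tiling, is connected. In particular, finite connected tilings (polyominoes) are simulated by polyominoes only. -/
namespace Paper

open scoped Classical

abbrev Pos : Type := ℤ × ℤ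

/-- The von Neumann neighborhood. -/
def Nvn : Set Pos := {(0, 1), (1, 0), (0, -1), (-1, 0)}

/-- A neighborhood: a finite symmetric set of positions not containing the origin. -/
def IsNeighborhood (N : Set Pos) : Prop :=
  N.Finite ∧ (0, 0) ∉ N ∧ ∀ w ∈ N, -w ∈ N

/-- A tile over glues `X` and neighborhood `N` : a function from `N` to `X`. -/
abbrev Tile (X : Type) (N : Set Pos) : Type := {w : Pos // w ∈ N} → X

/-- Scaling a position by an integer. -/
def sc (s : ℤ) (u : Pos) : Pos := (s * u.1, s * u.2)

/-- Domain of a partial map on the plane. -/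
def tdom {α : Type} (τ : Pos → Option α) : Set Pos := {p | τ p ≠ none}

/-- A (T,N)-tiling: a partial map to tiles of `T` such that all neighboring glues match. -/
def IsTiling {X : Type} {N : Set Pos} (T : Set (Tile X N))
    (τ : Pos → Option (Tile X N)) : Prop :=
  (∀ p t, τ p = some t → t ∈ T) ∧
  (∀ p t, τ p = some t → ∀ w t', τ (p + w) = some t' →
    ∀ (hw : w ∈ N) (hw' : -w ∈ N), t ⟨w, hw⟩ = t' ⟨-w, hw'⟩)

def IsFiniteTiling {X : Type} {N : Set Pos} (T : Set (Tile X N))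
    (τ : Pos → Option (Tile X N)) : Prop :=
  IsTiling T τ ∧ (tdom τ).Finite

/-- A partial map on the plane is total if it is defined everywhere. -/
def TotalDom {α : Type} (τ : Pos → Option α) : Prop := ∀ p, τ p ≠ none

/-- A poly-tiling of scale `s`: a partial map from grid positions to finite tilings,
satisfying (i) each component is a finite tiling, (ii) translated domains are disjoint,
(iii) neighboring (after translation) tiles of two components have matching glues. -/
def IsPolyTiling {X : Type} {N : Set Pos} (T : Set (Tile X N)) (s : ℤ)
    (σ : Pos → Option (Pos → Option (Tile X N))) : Prop :=
  (∀ u τu, σ u = some τu → IsFiniteTiling T τu) ∧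
  (∀ u v τu τv, u ≠ v → σ u = some τu → σ v = some τv →
    ∀ p, τu p ≠ none → ∀ q, τv q ≠ none → sc s u + p ≠ sc s v + q) ∧
  (∀ u u' τu τu', σ u = some τu → σ u' = some τu' →
    ∀ v t, τu v = some t → ∀ v' t', τu' v' = some t' →
    ∀ (hw : (sc s u' + v') - (sc s u + v) ∈ N)
      (hw' : -((sc s u' + v') - (sc s u + v)) ∈ N),
      t ⟨(sc s u' + v') - (sc s u + v), hw⟩ =
        t' ⟨-((sc s u' + v') - (sc s u + v)), hw'⟩)

/-- The tiling induced by a poly-tiling: position `s•u + v` carries the tile `σ u v`. -/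
noncomputable def induced {α : Type} (s : ℤ) (σ : Pos → Option (Pos → Option α)) :
    Pos → Option α := fun p =>
  if h : ∃ t, ∃ u τu v, σ u = some τu ∧ τu v = some t ∧ p = sc s u + v
    then some h.choose else none

/-- Periodicity of a (partial) tiling, with horizontal and vertical periods. -/
def PeriodicT {α : Type} (τ : Pos → Option α) : Prop :=
  ∃ ph pv : ℤ, 0 < ph ∧ 0 < pv ∧
    ∀ (p : Pos) (a b : ℤ), τ p ≠ none →
      τ (p.1 + a * ph, p.2 + b * pv) ≠ none →
      τ p = τ (p.1 + a * ph, p.2 + b * pv)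

def LineConvex {α : Type} (τ : Pos → Option α) : Prop :=
  ∀ x₁ x₂ x y : ℤ, τ (x₁, y) ≠ none → τ (x₂, y) ≠ none →
    x₁ < x → x < x₂ → τ (x, y) ≠ none

def ColumnConvex {α : Type} (τ : Pos → Option α) : Prop :=
  ∀ x y₁ y₂ y : ℤ, τ (x, y₁) ≠ none → τ (x, y₂) ≠ none →
    y₁ < y → y < y₂ → τ (x, y) ≠ none

/-- 4-connectedness of a set of positions. -/
def ConnectedDom (D : Set Pos) : Prop :=
  ∀ p ∈ D, ∀ q ∈ D, ∃ (n : ℕ) (c : ℕ → Pos), c 0 = p ∧ c n = q ∧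
    (∀ k ≤ n, c k ∈ D) ∧ ∀ k < n, c (k + 1) - c k ∈ Nvn

/-- The connected linear neighborhood `N_n`. -/
def Nlin (n : ℤ) : Set Pos := {w | w.2 = 0 ∧ 0 < |w.1| ∧ |w.1| ≤ n}

/-- The rectangular neighborhood `N_{m,n}`. -/
def Nrect (m n : ℤ) : Set Pos := {w | |w.1| ≤ m ∧ |w.2| ≤ n ∧ w ≠ (0, 0)}

/-- A set of consecutive integers. -/
def IsInterval (I : Set ℤ) : Prop :=
  ∀ a b c : ℤ, a ∈ I → c ∈ I → a ≤ b → b ≤ c → b ∈ I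

/-- A path: a map from a set of consecutive integers to the plane, consecutive
positions being (von Neumann) adjacent. -/
def IsPath (I : Set ℤ) (P : ℤ → Pos) : Prop :=
  IsInterval I ∧ ∀ i : ℤ, i ∈ I → i + 1 ∈ I → P (i + 1) - P i ∈ Nvn

/-- A T-tiled path: a path together with a map from its range to tiles of `T`. -/
def IsTiledPath {X : Type} {N : Set Pos} (T : Set (Tile X N)) (I : Set ℤ)
    (P : ℤ → Pos) (r : Pos → Option (Tile X N)) : Prop :=
  IsPath I P ∧ tdom r = P '' I ∧ ∀ p t, r p = some t → t ∈ T

/-- A T-ribbon: an injective tiled path in which consecutive tiles stick. -/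
def IsRibbon {X : Type} (T : Set (Tile X Nvn)) (I : Set ℤ) (P : ℤ → Pos)
    (r : Pos → Option (Tile X Nvn)) : Prop :=
  IsTiledPath T I P r ∧ (∀ i ∈ I, ∀ j ∈ I, P i = P j → i = j) ∧
  (∀ i : ℤ, i ∈ I → i + 1 ∈ I → ∀ t t', r (P i) = some t → r (P (i + 1)) = some t' →
    ∀ (hv : P (i + 1) - P i ∈ Nvn) (hv' : -(P (i + 1) - P i) ∈ Nvn),
      t ⟨P (i + 1) - P i, hv⟩ = t' ⟨-(P (i + 1) - P i), hv'⟩)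

/-- A (T,N)-zipper: an injective tiled path whose tile map is a (T,N)-tiling. -/
def IsZipper {X : Type} {N : Set Pos} (T : Set (Tile X N)) (I : Set ℤ)
    (P : ℤ → Pos) (r : Pos → Option (Tile X N)) : Prop :=
  IsTiledPath T I P r ∧ (∀ i ∈ I, ∀ j ∈ I, P i = P j → i = j) ∧ IsTiling T r

/-- Bundled T-ribbons (tile system in the von Neumann neighborhood). -/
structure Ribbon (X : Type) (T : Set (Tile X Nvn)) : Type where
  I : Set ℤ
  P : ℤ → Pos
  r : Pos → Option (Tile X Nvn)
  isRibbon : IsRibbon T I P r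

/-- A poly-ribbon of scale `s` with macro path `(J, Q)` and components `ρ`. -/
def IsPolyRibbon {X : Type} {T : Set (Tile X Nvn)} (s : ℤ) (J : Set ℤ)
    (Q : ℤ → Pos) (ρ : Pos → Option (Ribbon X T)) : Prop :=
  IsPath J Q ∧ (∀ i ∈ J, ∀ j ∈ J, Q i = Q j → i = j) ∧
  tdom ρ = Q '' J ∧
  (∀ u R, ρ u = some R → R.I.Finite ∧ R.I.Nonempty) ∧
  (∀ u v R S, u ≠ v → ρ u = some R → ρ v = some S →
    ∀ p, R.r p ≠ none → ∀ q, S.r q ≠ none → sc s u + p ≠ sc s v + q) ∧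
  (∀ j : ℤ, j ∈ J → j + 1 ∈ J → ∀ R₁ R₂, ρ (Q j) = some R₁ → ρ (Q (j + 1)) = some R₂ →
    ∀ m₁, IsGreatest R₁.I m₁ → ∀ m₂, IsLeast R₂.I m₂ →
      ((sc s (Q (j + 1)) + R₂.P m₂) - (sc s (Q j) + R₁.P m₁) ∈ Nvn ∧
      ∀ t₁ t₂, R₁.r (R₁.P m₁) = some t₁ → R₂.r (R₂.P m₂) = some t₂ →
        ∀ (hv : (sc s (Q (j + 1)) + R₂.P m₂) - (sc s (Q j) + R₁.P m₁) ∈ Nvn)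
          (hv' : -((sc s (Q (j + 1)) + R₂.P m₂) - (sc s (Q j) + R₁.P m₁)) ∈ Nvn),
          t₁ ⟨(sc s (Q (j + 1)) + R₂.P m₂) - (sc s (Q j) + R₁.P m₁), hv⟩ =
            t₂ ⟨-((sc s (Q (j + 1)) + R₂.P m₂) - (sc s (Q j) + R₁.P m₁)), hv'⟩))

/-- A zipper-simulation of `T` (in neighborhood `N`) by `Tμ` (in the von Neumann
neighborhood), of scale `s`, consisting of a polyomino assignment `phi`, the
trimming map `chi` and the simulation map `psi`. -/
structure ZipperSimulation (X Xμ : Type) (N : Set Pos) (T : Set (Tile X N))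
    (Tμ : Set (Tile Xμ Nvn)) (s : ℤ) : Type where
  hs : 1 ≤ s
  phi : Tile X N → Set (Ribbon Xμ Tμ)
  phi_fin : ∀ t, ∀ R ∈ phi t, R.I.Finite ∧ R.I.Nonempty
  phi_ref : ∀ t, ∀ R ∈ phi t, R.r (0, 0) ≠ none
  phi_spec : ∀ t t', t ≠ t' → ∀ R ∈ phi t, ∀ S ∈ phi t',
    ∀ p q a b, R.r p = some a → S.r q = some b → a ≠ b
  chi : Ribbon Xμ Tμ → Pos → Option (Ribbon Xμ Tμ)
  chi_poly : ∀ R : Ribbon Xμ Tμ, ∃ J Q, IsPolyRibbon s J Q (chi R)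
  chi_sub : ∀ R u S, chi R u = some S →
    (∃ t ∈ T, S ∈ phi t) ∧ ∀ p a, S.r p = some a → R.r (sc s u + p) = some a
  chi_max : ∀ (R : Ribbon Xμ Tμ) (t : Tile X N), t ∈ T → ∀ S ∈ phi t, ∀ u : Pos,
    (∀ p a, S.r p = some a → R.r (sc s u + p) = some a) → chi R u ≠ none
  psi : Set ℤ → (ℤ → Pos) → (Pos → Option (Tile X N)) → Set (Pos → Option (Ribbon Xμ Tμ))
  psi_nonempty : ∀ I P r, IsZipper T I P r → (psi I P r).Nonempty
  psi_poly : ∀ I P r, IsZipper T I P r → ∀ ρ ∈ psi I P r, IsPolyRibbon s I P ρ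
  psi_comp : ∀ I P r, IsZipper T I P r → ∀ ρ ∈ psi I P r,
    ∀ u t, r u = some t → ∀ S, ρ u = some S → S ∈ phi t
  psi_exists : ∀ R : Ribbon Xμ Tμ, ∃ I P r, IsZipper T I P r ∧ chi R ∈ psi I P r
  psi_unique : ∀ (R : Ribbon Xμ Tμ) I P r I' P' r',
    IsZipper T I P r → IsZipper T I' P' r' →
    chi R ∈ psi I P r → chi R ∈ psi I' P' r' →
    r = r' ∧ ∃ d : ℤ, (∀ i, i ∈ I ↔ i + d ∈ I') ∧ ∀ i ∈ I, P' (i + d) = P i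

/-- A tiling-simulation of `T` (in neighborhood `N`) by `Tμ` (in the von Neumann
neighborhood), of scale `s`, consisting of a polyomino assignment `phi`, the
trimming map `chi` and the simulation map `psi`. -/
structure TilingSimulation (X Xμ : Type) (N : Set Pos) (T : Set (Tile X N))
    (Tμ : Set (Tile Xμ Nvn)) (s : ℤ) : Type where
  hs : 1 ≤ s
  phi : Tile X N → Set (Pos → Option (Tile Xμ Nvn))
  phi_fin : ∀ t, ∀ τ' ∈ phi t, IsFiniteTiling Tμ τ'
  phi_ref : ∀ t, ∀ τ' ∈ phi t, τ' (0, 0) ≠ none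
  phi_spec : ∀ t t', t ≠ t' → ∀ τ₁ ∈ phi t, ∀ τ₂ ∈ phi t',
    ∀ p q a b, τ₁ p = some a → τ₂ q = some b → a ≠ b
  chi : (Pos → Option (Tile Xμ Nvn)) → Pos → Option (Pos → Option (Tile Xμ Nvn))
  chi_poly : ∀ τ', IsTiling Tμ τ' → IsPolyTiling Tμ s (chi τ')
  chi_sub : ∀ τ' u σu, chi τ' u = some σu →
    (∃ t ∈ T, σu ∈ phi t) ∧ ∀ p a, σu p = some a → τ' (sc s u + p) = some a
  chi_max : ∀ (τ' : Pos → Option (Tile Xμ Nvn)) (t : Tile X N), t ∈ T →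
    ∀ σu ∈ phi t, ∀ u : Pos,
    (∀ p a, σu p = some a → τ' (sc s u + p) = some a) → chi τ' u ≠ none
  psi : (Pos → Option (Tile X N)) → Set (Pos → Option (Pos → Option (Tile Xμ Nvn)))
  psi_nonempty : ∀ τ, IsTiling T τ → (psi τ).Nonempty
  psi_poly : ∀ τ, IsTiling T τ → ∀ σ ∈ psi τ, IsPolyTiling Tμ s σ
  psi_dom : ∀ τ, IsTiling T τ → ∀ σ ∈ psi τ, ∀ u, σ u ≠ none ↔ τ u ≠ none
  psi_comp : ∀ τ, IsTiling T τ → ∀ σ ∈ psi τ,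
    ∀ u t, τ u = some t → ∀ σu, σ u = some σu → σu ∈ phi t
  psi_recover : ∀ τ', IsTiling Tμ τ' → ∃! τ, IsTiling T τ ∧ chi τ' ∈ psi τ

/-- One step inside `D` between von Neumann neighbors. -/
def Step (D : Set Pos) (p q : Pos) : Prop := p ∈ D ∧ q ∈ D ∧ q - p ∈ Nvn

/-- Two positions joined by a walk inside `D`. -/
abbrev Joined (D : Set Pos) : Pos → Pos → Prop := Relation.ReflTransGen (Step D)

theorem neg_mem_Nvn {w : Pos} (h : w ∈ Nvn) : -w ∈ Nvn := by
  simp only [Nvn, Set.mem_insert_iff, Set.mem_singleton_iff] at h ⊢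
  rcases h with rfl | rfl | rfl | rfl <;> simp

theorem Step.symm {D : Set Pos} {p q : Pos} (h : Step D p q) : Step D q p :=
  ⟨h.2.1, h.1, by simpa using neg_mem_Nvn h.2.2⟩

theorem Joined.symm {D : Set Pos} {p q : Pos} (h : Joined D p q) : Joined D q p := by
  induction h with
  | refl => exact .refl
  | tail _ hbc ih => exact .head hbc.symm ih

theorem Joined.map {D E : Set Pos} (f : Pos → Pos)
    (hf : ∀ a b, Step D a b → Joined E (f a) (f b)) {p q : Pos} (h : Joined D p q) :
    Joined E (f p) (f q) := by
  induction h with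
  | refl => exact .refl
  | tail _ hbc ih => exact ih.trans (hf _ _ hbc)

theorem connectedDom_iff {D : Set Pos} :
    ConnectedDom D ↔ ∀ p ∈ D, ∀ q ∈ D, Joined D p q := by
  constructor
  · intro h p hp q hq
    obtain ⟨n, c, rfl, rfl, hc, hs⟩ := h p hp q hq
    have key : ∀ k ≤ n, Joined D (c 0) (c k) := by
      intro k
      induction k with
      | zero => intro _; exact .refl
      | succ k ih =>
        intro hk
        exact (ih (by omega)).tail ⟨hc k (by omega), hc (k + 1) hk, hs k (by omega)⟩
    exact key n le_rfl
  · intro h p hp q hq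
    have := h p hp q hq
    clear h
    induction this with
    | refl => exact ⟨0, fun _ => p, rfl, rfl, fun _ _ => hp, fun k hk => by omega⟩
    | @tail b c _ hbc ih =>
      obtain ⟨n, f, h0, hn, hD, hs⟩ := ih hbc.1
      refine ⟨n + 1, fun k => if k ≤ n then f k else c, by simp [h0], by simp, ?_, ?_⟩
      · intro k hk
        by_cases hkn : k ≤ n
        · simpa [hkn] using hD k hkn
        · simpa [hkn] using hq
      · intro k hk
        rcases Nat.lt_or_ge k n with hkn | hkn
        · have h1 : k + 1 ≤ n := hkn
          simpa [h1, hkn.le] using hs k hkn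
        · obtain rfl : k = n := by omega
          simpa [hn] using hbc.2.2

theorem joined_vertical {D : Set Pos} {x y y' : ℤ} (hyy : y ≤ y')
    (h : ∀ z, y ≤ z → z ≤ y' → (x, z) ∈ D) : Joined D (x, y) (x, y') := by
  induction y', hyy using Int.leInduction with
  | base => exact .refl
  | succ k hk ih =>
    refine (ih fun z h1 h2 => h z h1 (by omega)).tail
      ⟨h k hk (by omega), h (k + 1) (by omega) le_rfl, ?_⟩
    simp [Nvn]

theorem joined_preimage {D : Set Pos} (f : Pos → Pos) (hf : Function.Surjective f)
    (h : ∀ a ∈ D, ∀ b ∈ D, (b = a ∨ b = a + (1, 0) ∨ b = a + (0, 1)) →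
      ∀ p p', f p = a → f p' = b → Joined (f ⁻¹' D) p p')
    (hD : ConnectedDom D) : ConnectedDom (f ⁻¹' D) := by
  rw [connectedDom_iff] at hD ⊢
  intro p hp q hq
  have hj : Joined D (f p) (f q) := hD _ hp _ hq
  have key : ∀ b, Joined D (f p) b → b ∈ D → ∀ q, f q = b → Joined (f ⁻¹' D) p q := by
    intro b hb
    induction hb with
    | refl => intro hb q hq; exact h _ hb _ hb (.inl rfl) _ _ rfl hq
    | @tail b c _ hbc ih =>
      intro _ q hq
      obtain ⟨r, hr⟩ := hf b
      refine (ih hbc.1 r hr).trans ?_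
      obtain ⟨hb, hc, hv⟩ := hbc
      simp only [Nvn, Set.mem_insert_iff, Set.mem_singleton_iff] at hv
      rcases hv with hv | hv | hv | hv
      · exact h b hb c hc (.inr (.inr (by rw [← hv]; abel))) _ _ hr hq
      · exact h b hb c hc (.inr (.inl (by rw [← hv]; abel))) _ _ hr hq
      · refine (h c hc b hb (.inr (.inr ?_)) _ _ hq hr).symm
        have := sub_eq_iff_eq_add'.mp hv
        rw [this]; ext <;> simp
      · refine (h c hc b hb (.inr (.inl ?_)) _ _ hq hr).symm
        have := sub_eq_iff_eq_add'.mp hv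
        rw [this]; ext <;> simp
  exact key _ hj hq q rfl

/-- Connectedness pulls back along a map acting monotonically on each column, when the
level sets in neighboring columns overlap. -/
theorem connectedDom_preimage_column {D : Set Pos} (ψ : ℤ → ℤ → ℤ)
    (hmono : ∀ x, Monotone (ψ x))
    (hov : ∀ x j, ∃ y, ψ x y = j ∧ ψ (x + 1) y = j) (hD : ConnectedDom D) :
    ConnectedDom ((fun p : Pos => ((p.1, ψ p.1 p.2) : Pos)) ⁻¹' D) := by
  have vert : ∀ x j j' y y', (x, j) ∈ D → (x, j') ∈ D → (j' = j ∨ j' = j + 1) →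
      ψ x y = j → ψ x y' = j' →
      Joined ((fun p : Pos => ((p.1, ψ p.1 p.2) : Pos)) ⁻¹' D) (x, y) (x, y') := by
    intro x j j' y y' hj hj' hjj hy hy'
    have mem : ∀ z, j ≤ ψ x z → ψ x z ≤ j' → (x, ψ x z) ∈ D := by
      intro z h1 h2
      have : ψ x z = j ∨ ψ x z = j' := by omega
      rcases this with h | h <;> rw [h] <;> assumption
    rcases le_total y y' with h | h
    · refine joined_vertical h fun z h1 h2 => mem z ?_ ?_
      · rw [← hy]; exact hmono x h1
      · rw [← hy']; exact hmono x h2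
    · refine (joined_vertical h fun z h1 h2 => mem z ?_ ?_).symm
      · have := hmono x h1; omega
      · have := hmono x h2; omega
  refine joined_preimage _ ?_ ?_ hD
  · rintro ⟨x, j⟩
    obtain ⟨y, hy, -⟩ := hov x j
    exact ⟨(x, y), by simp [hy]⟩
  · rintro ⟨x, j⟩ ha b hb hab ⟨x₁, y⟩ ⟨x₂, y'⟩ hp hp'
    rcases hab with rfl | rfl | rfl
    · simp only [Prod.mk.injEq] at hp hp'
      obtain ⟨rfl, hp⟩ := hp
      obtain ⟨rfl, hp'⟩ := hp'
      exact vert _ j j _ _ ha ha (.inl rfl) hp hp'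
    · simp only [Prod.mk.injEq, Prod.mk_add_mk, add_zero] at hp hp' hb
      obtain ⟨rfl, hp⟩ := hp
      obtain ⟨rfl, hp'⟩ := hp'
      obtain ⟨z, hz, hz'⟩ := hov x₁ j
      refine (vert _ j j _ z ha ha (.inl rfl) hp hz).trans (.trans (.single ?_)
        (vert _ j j z _ hb hb (.inl rfl) hz' hp'))
      refine ⟨?_, ?_, by simp [Nvn]⟩
      · simpa [hz] using ha
      · simpa [hz'] using hb
    · simp only [Prod.mk.injEq, Prod.mk_add_mk, add_zero] at hp hp' hb
      obtain ⟨rfl, hp⟩ := hp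
      obtain ⟨rfl, hp'⟩ := hp'
      exact vert _ j (j + 1) _ _ ha hb (.inr rfl) hp hp'

theorem ConnectedDom.preimage_swap {D : Set Pos} (hD : ConnectedDom D) :
    ConnectedDom ((Prod.swap : Pos → Pos) ⁻¹' D) := by
  rw [connectedDom_iff] at hD ⊢
  intro p hp q hq
  have := (hD _ hp _ hq).map (E := (Prod.swap : Pos → Pos) ⁻¹' D) Prod.swap fun a b hab =>
    .single ⟨by simpa using hab.1, by simpa using hab.2.1, by
      have := hab.2.2
      simp only [Nvn, Set.mem_insert_iff, Set.mem_singleton_iff, Prod.ext_iff, Prod.fst_sub,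
        Prod.snd_sub, Prod.fst_swap, Prod.snd_swap] at this ⊢
      omega⟩
  simpa using this

/-- The row version of `connectedDom_preimage_column`. -/
theorem connectedDom_preimage_row {D : Set Pos} (ψ : ℤ → ℤ → ℤ)
    (hmono : ∀ y, Monotone (ψ y))
    (hov : ∀ y a, ∃ x, ψ y x = a ∧ ψ (y + 1) x = a) (hD : ConnectedDom D) :
    ConnectedDom ((fun p : Pos => ((ψ p.2 p.1, p.2) : Pos)) ⁻¹' D) :=
  (connectedDom_preimage_column ψ hmono hov hD.preimage_swap).preimage_swap


/-- Dimensions of the plane layout: `R` bounds the neighborhood and `K` the number of tiles. -/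
structure Layout : Type where
  R : ℤ
  K : ℤ
  n : ℤ
  W : ℤ
  o : ℤ
  q : ℤ
  e : ℤ
  w : ℤ
  s : ℤ
  S : ℤ
  m : ℤ
  R_pos : 1 ≤ R
  K_pos : 1 ≤ K
  n_eq : n = 8 * R + 2
  q_eq : q = 2 * e
  e_eq : e = R + 2
  W_pos : 1 ≤ W
  o_eq : o = 2 * W * K
  w_eq : w = q * o
  s_eq : s = 2 * w
  S_big : 2 ≤ S
  m_eq : m = 2 * S
  s_eq_mul : s = m * n
  S_mul_W : S * W = (R + 1) * s

/-- The layout determined by the radius of the neighborhood and the number of tiles. -/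
def Layout.mk' (R K : ℤ) (hR : 1 ≤ R) (hK : 1 ≤ K) : Layout where
  R := R
  K := K
  n := 8 * R + 2
  W := 2 * (R + 1) * (8 * R + 2)
  o := 2 * (2 * (R + 1) * (8 * R + 2)) * K
  q := 2 * (R + 2)
  e := R + 2
  w := 2 * (R + 2) * (2 * (2 * (R + 1) * (8 * R + 2)) * K)
  s := 2 * (2 * (R + 2) * (2 * (2 * (R + 1) * (8 * R + 2)) * K))
  S := 4 * (2 * (R + 2)) * (R + 1) * K
  m := 2 * (4 * (2 * (R + 2)) * (R + 1) * K)
  R_pos := hR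
  K_pos := hK
  n_eq := rfl
  q_eq := rfl
  e_eq := rfl
  W_pos := by nlinarith
  o_eq := rfl
  w_eq := rfl
  s_eq := rfl
  S_big := by
    have h1 : 1 ≤ (R + 1) * K := by nlinarith
    nlinarith
  m_eq := rfl
  s_eq_mul := by ring
  S_mul_W := by ring

namespace Layout

variable (L : Layout)

theorem o_ge : 2 * L.W ≤ L.o := by
  rw [L.o_eq]; nlinarith [L.W_pos, L.K_pos]

theorem o_pos : 2 ≤ L.o := by linarith [L.o_ge, L.W_pos]

theorem w_eq' : L.w = (2 * L.R + 4) * L.o := by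
  rw [L.w_eq, L.q_eq, L.e_eq]; ring

theorem w_pos : 2 ≤ L.w := by
  rw [L.w_eq']; nlinarith [L.R_pos, L.o_pos]

theorem e_succ_mul_o_lt : (L.e + 1) * L.o + 1 ≤ L.w := by
  rw [L.w_eq', L.e_eq]; nlinarith [L.R_pos, L.o_pos]

theorem m_pos : 4 ≤ L.m := by linarith [L.m_eq, L.S_big]

theorem n_pos : 10 ≤ L.n := by linarith [L.n_eq, L.R_pos]

theorem s_pos : 4 ≤ L.s := by linarith [L.s_eq, L.w_pos]

theorem q_pos : 6 ≤ L.q := by linarith [L.q_eq, L.e_eq, L.R_pos]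

/-- Sheared and halved horizontal coordinate. -/
def zeta (p : Pos) : ℤ := (p.1 - (p.2 + 1) / L.q) / 2

/-- Horizontal center of the tube of tile number `i` at `u`. -/
def center (u : Pos) (i : ℤ) : ℤ :=
  L.w * u.1 - L.o * u.2 + L.R * L.w + 2 * L.W * i + L.W

/-- Lowest height of the tubes of `u`. -/
def foot (u : Pos) : ℤ := L.s * u.2 + 2 * L.R * L.m

/-- Pyramid over the tube of tile number `i` at `u`. -/
def roof (u : Pos) (i z y : ℤ) : ℤ :=
  L.S * L.W - max (L.S * |z - L.center u i|) |y - (L.foot u + L.S * L.W)|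

/-- Vertical displacement caused by the active tubes. -/
noncomputable def push (A : Pos → ℤ → Prop) (z y : ℤ) : ℤ :=
  if h : ∃ u i, A u i ∧ 0 ≤ i ∧ i < L.K ∧ 0 < L.roof u i z y then
    L.roof h.choose h.choose_spec.choose z y
  else 0

/-- Thin row containing a point. -/
noncomputable def lev (A : Pos → ℤ → Prop) (z y : ℤ) : ℤ := (y - L.push A z y) / L.m

/-- Horizontal offset of thin row `j`. -/
def lam (j : ℤ) : ℤ := L.o * (L.e * min (j % L.n) (L.n - 1 - j % L.n) - (j + 1) / L.n)

/-- The cell containing a point, when the active tubes are those of `A`. -/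
noncomputable def cell (A : Pos → ℤ → Prop) (p : Pos) : Pos :=
  ((L.zeta p - L.lam (L.lev A (L.zeta p) p.2)) / L.w, L.lev A (L.zeta p) p.2 / L.n)

theorem roof_pos_iff {u : Pos} {i z y : ℤ} : 0 < L.roof u i z y ↔
    |z - L.center u i| < L.W ∧ L.foot u < y ∧ y < L.foot u + 2 * (L.S * L.W) := by
  have hS := L.S_big
  rw [roof, sub_pos, max_lt_iff, mul_lt_mul_iff_right₀ (by omega), abs_lt (a := y - _)]
  constructor <;> rintro ⟨h1, h2, h3⟩ <;> refine ⟨h1, ?_, ?_⟩ <;> linarith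

theorem roof_le_sub_foot (u : Pos) (i z y : ℤ) : L.roof u i z y ≤ y - L.foot u := by
  have h1 := le_max_right (L.S * |z - L.center u i|) |y - (L.foot u + L.S * L.W)|
  have h2 := neg_abs_le (y - (L.foot u + L.S * L.W))
  unfold roof
  linarith

theorem roof_le (u : Pos) (i z y : ℤ) : L.roof u i z y ≤ L.S * L.W := by
  have h1 := le_max_right (L.S * |z - L.center u i|) |y - (L.foot u + L.S * L.W)|
  have h2 := abs_nonneg (y - (L.foot u + L.S * L.W))
  unfold roof
  linarith

theorem roof_lipschitz (u : Pos) (i : ℤ) {z z' y y' c : ℤ} (hz : L.S * |z' - z| ≤ c)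
    (hy : |y' - y| ≤ c) : L.roof u i z y ≤ L.roof u i z' y' + c := by
  have hS := L.S_big
  have h1 : L.S * |z' - L.center u i| ≤ L.S * |z - L.center u i| + c := by
    have := abs_add_le (z' - z) (z - L.center u i)
    rw [sub_add_sub_cancel] at this
    nlinarith
  have h2 : |y' - (L.foot u + L.S * L.W)| ≤ |y - (L.foot u + L.S * L.W)| + c := by
    have := abs_add_le (y' - y) (y - (L.foot u + L.S * L.W))
    rw [sub_add_sub_cancel] at this
    linarith
  unfold roof
  have h3 : max (L.S * |z' - L.center u i|) |y' - (L.foot u + L.S * L.W)| ≤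
      max (L.S * |z - L.center u i|) |y - (L.foot u + L.S * L.W)| + c :=
    max_le (h1.trans (by gcongr; exact le_max_left _ _))
      (h2.trans (by gcongr; exact le_max_right _ _))
  linarith

theorem eq_zero_of_abs_mul_lt {c a : ℤ} (h : |c * a| < c) : a = 0 := by
  have hc : 0 < c := (abs_nonneg _).trans_lt h
  rw [abs_mul, abs_of_pos hc] at h
  have : |a| < 1 := by nlinarith
  exact Int.abs_lt_one_iff.mp this

/-- Distinct tubes have disjoint pyramids. -/
theorem roof_pos_unique {u v : Pos} {i j z y : ℤ} (hi : 0 ≤ i) (hiK : i < L.K) (hj : 0 ≤ j)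
    (hjK : j < L.K) (hu : 0 < L.roof u i z y) (hv : 0 < L.roof v j z y) : u = v ∧ i = j := by
  rw [roof_pos_iff] at hu hv
  obtain ⟨h1, h2, h3⟩ := hu
  obtain ⟨k1, k2, k3⟩ := hv
  rw [L.S_mul_W] at h3 k3
  rw [abs_lt] at h1 k1
  unfold center at h1 k1
  unfold foot at h2 h3 k2 k3
  have hW := L.W_pos
  have ho := L.o_eq
  have hs := L.s_pos
  have hij : |2 * L.W * (i - j)| ≤ L.o - 2 * L.W := by
    rw [abs_le, ho]
    constructor <;> nlinarith
  rw [abs_le] at hij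
  have hd : u.2 - v.2 = L.q * (u.1 - v.1) := by
    have : L.q * (u.1 - v.1) - (u.2 - v.2) = 0 := by
      apply eq_zero_of_abs_mul_lt (c := L.o)
      rw [show L.o * (L.q * (u.1 - v.1) - (u.2 - v.2)) =
        (L.w * u.1 - L.o * u.2) - (L.w * v.1 - L.o * v.2) by rw [L.w_eq]; ring, abs_lt]
      constructor <;> linarith
    linarith
  have hb : |u.2 - v.2| < 2 * (L.R + 1) := by
    rw [abs_lt]
    constructor <;> nlinarith
  have h0 : u.1 - v.1 = 0 := by
    apply eq_zero_of_abs_mul_lt (c := L.q)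
    rw [← hd]
    linarith [L.q_eq, L.e_eq]
  rw [h0, mul_zero] at hd
  have e1 : u.1 = v.1 := by linarith
  have e2 : u.2 = v.2 := by linarith
  refine ⟨Prod.ext e1 e2, ?_⟩
  have : i - j = 0 := by
    apply eq_zero_of_abs_mul_lt (c := 2 * L.W)
    rw [e1, e2] at h1
    rw [abs_lt]
    constructor <;> linarith
  linarith

section Push

variable {A : Pos → ℤ → Prop}

theorem push_eq_roof {u : Pos} {i z y : ℤ} (hA : A u i) (hi : 0 ≤ i) (hiK : i < L.K)
    (h : 0 < L.roof u i z y) : L.push A z y = L.roof u i z y := by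
  have hex : ∃ u i, A u i ∧ 0 ≤ i ∧ i < L.K ∧ 0 < L.roof u i z y := ⟨u, i, hA, hi, hiK, h⟩
  rw [push, dif_pos hex]
  obtain ⟨-, h1, h2, h3⟩ := hex.choose_spec.choose_spec
  obtain ⟨e1, e2⟩ := L.roof_pos_unique h1 h2 hi hiK h3 h
  exact congrArg₂ (fun u i => L.roof u i z y) e1 e2

theorem push_eq_zero {z y : ℤ} (h : ∀ u i, A u i → 0 ≤ i → i < L.K → L.roof u i z y ≤ 0) :
    L.push A z y = 0 := by
  rw [push, dif_neg]
  rintro ⟨u, i, hA, hi, hiK, hr⟩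
  exact absurd (h u i hA hi hiK) (not_le.mpr hr)

theorem push_cases (A : Pos → ℤ → Prop) (z y : ℤ) : L.push A z y = 0 ∨
    ∃ u i, A u i ∧ 0 ≤ i ∧ i < L.K ∧ 0 < L.roof u i z y ∧ L.push A z y = L.roof u i z y := by
  by_cases h : ∃ u i, A u i ∧ 0 ≤ i ∧ i < L.K ∧ 0 < L.roof u i z y
  · obtain ⟨u, i, hA, hi, hiK, hr⟩ := h
    exact .inr ⟨u, i, hA, hi, hiK, hr, L.push_eq_roof hA hi hiK hr⟩
  · exact .inl (by rw [push, dif_neg h])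

theorem push_nonneg (A : Pos → ℤ → Prop) (z y : ℤ) : 0 ≤ L.push A z y := by
  rcases L.push_cases A z y with h | ⟨u, i, -, -, -, hr, h⟩ <;> omega

theorem push_le (A : Pos → ℤ → Prop) (z y : ℤ) : L.push A z y ≤ L.S * L.W := by
  rcases L.push_cases A z y with h | ⟨u, i, -, -, -, hr, h⟩
  · rw [h]; have := L.S_big; have := L.W_pos; positivity
  · rw [h]; exact L.roof_le _ _ _ _

theorem push_lipschitz (A : Pos → ℤ → Prop) {z z' y y' c : ℤ} (hz : L.S * |z' - z| ≤ c)
    (hy : |y' - y| ≤ c) : L.push A z y ≤ L.push A z' y' + c := by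
  have hc : 0 ≤ c := (abs_nonneg _).trans hy
  have h0 := L.push_nonneg A z' y'
  rcases L.push_cases A z y with h | ⟨u, i, hA, hi, hiK, hr, h⟩
  · omega
  · have h1 := L.roof_lipschitz u i hz hy
    rcases lt_or_ge 0 (L.roof u i z' y') with h2 | h2
    · rw [h, L.push_eq_roof hA hi hiK h2]; exact h1
    · omega

theorem push_shift (A : Pos → ℤ → Prop) (v : Pos) (z y : ℤ) :
    L.push (fun u i => A (u - v) i) (z + (L.w * v.1 - L.o * v.2)) (y + L.s * v.2) =
      L.push A z y := by
  have hroof : ∀ u i, L.roof u i (z + (L.w * v.1 - L.o * v.2)) (y + L.s * v.2) =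
      L.roof (u - v) i z y := by
    intro u i
    unfold roof center foot
    simp only [Prod.fst_sub, Prod.snd_sub]
    ring_nf
  rcases L.push_cases A z y with h | ⟨u, i, hA, hi, hiK, hr, h⟩
  · rw [h]
    refine L.push_eq_zero fun u i hA hi hiK => ?_
    rw [hroof]
    by_contra hr
    rw [not_le] at hr
    rw [L.push_eq_roof hA hi hiK hr] at h
    omega
  · have := hroof (u + v) i
    rw [add_sub_cancel_right] at this
    rw [h, L.push_eq_roof (u := u + v) (by simpa using hA) hi hiK (by rwa [this]), this]

/-- The walls between two rows of cells are not displaced at the corners of cells. -/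
theorem push_eq_zero_of_corner (A : Pos → ℤ → Prop) {z y v Y a : ℤ}
    (hv : v = y ∨ v = y - L.push A z y) (h1 : L.s * Y - L.m ≤ v) (h2 : v < L.s * Y + L.m)
    (hz : z + L.o * Y = L.w * a ∨ z + L.o * Y = L.w * a - 1) : L.push A z y = 0 := by
  rcases L.push_cases A z y with h | ⟨u, i, hA, hi, hiK, hr, h⟩
  · exact h
  exfalso
  have hf := L.roof_le_sub_foot u i z y
  obtain ⟨r1, r2, r3⟩ := L.roof_pos_iff.mp hr
  have hv1 : L.foot u ≤ v := by rcases hv with hv | hv <;> omega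
  have hv2 : v < L.foot u + 2 * (L.S * L.W) := by rcases hv with hv | hv <;> omega
  rw [L.S_mul_W] at hv2
  unfold foot at hv1 hv2
  unfold center at r1
  rw [abs_lt] at r1
  have hs := L.s_pos
  have hm := L.m_pos
  have hR := L.R_pos
  have hW := L.W_pos
  have hw := L.w_pos
  have hsm : (2 * L.R + 1) * L.m < L.s := by rw [L.s_eq_mul, L.n_eq]; nlinarith
  have hb0 : 0 ≤ Y - u.2 := by
    by_contra hb
    nlinarith
  have hb1 : Y - u.2 ≤ 2 * L.R + 2 := by
    by_contra hb
    nlinarith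
  have ho := L.o_pos
  have hi2 : 2 * L.W * i ≤ L.o - 2 * L.W := by rw [L.o_eq]; nlinarith
  have hi0 : 0 ≤ 2 * L.W * i := by positivity
  have hob0 : 0 ≤ L.o * (Y - u.2) := by positivity
  have hob1 : L.o * (Y - u.2) ≤ L.w - 2 * L.o := by rw [L.w_eq']; nlinarith
  have hlo : 1 ≤ z + L.o * Y - L.w * (u.1 + L.R) := by linarith
  have hhi : z + L.o * Y - L.w * (u.1 + L.R) ≤ L.w - 2 := by linarith
  rcases hz with hz | hz
  · rw [hz, ← mul_sub] at hlo hhi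
    have : 0 < a - (u.1 + L.R) := by by_contra; nlinarith
    nlinarith
  · rw [hz] at hlo hhi
    have : 0 < a - (u.1 + L.R) := by by_contra; nlinarith
    nlinarith

end Push

theorem lam_add (j b : ℤ) : L.lam (j + L.n * b) = L.lam j - L.o * b := by
  have hn := L.n_pos
  unfold lam
  rw [Int.add_mul_emod_self_left, add_right_comm, Int.add_mul_ediv_left _ _ (by omega)]
  ring

theorem lam_of_lt {j : ℤ} (h0 : 0 ≤ j) (h1 : 2 * j < L.n) : L.lam j = L.o * L.e * j := by
  have hn := L.n_pos
  unfold lam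
  rw [Int.emod_eq_of_lt h0 (by omega), Int.ediv_eq_zero_of_lt (by omega) (by omega),
    min_eq_left (by omega)]
  ring

theorem lam_neg_one : L.lam (-1) = 0 := by
  have hn := L.n_pos
  have h : (-1 : ℤ) % L.n = L.n - 1 := by
    rw [← Int.add_emod_right, Int.emod_eq_of_lt] <;> omega
  unfold lam
  rw [h]
  simp only [sub_self, neg_add_cancel, Int.zero_ediv, sub_zero]
  rw [min_eq_right (by omega)]
  ring

theorem lam_mul (Y : ℤ) : L.lam (L.n * Y) = -(L.o * Y) := by
  have hn := L.n_pos
  have := L.lam_add 0 Y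
  rw [L.lam_of_lt le_rfl (by omega)] at this
  simpa using this

theorem lam_mul_sub_one (Y : ℤ) : L.lam (L.n * Y - 1) = -(L.o * Y) := by
  have := L.lam_add (-1) Y
  rw [L.lam_neg_one] at this
  rw [sub_eq_neg_add, this]
  ring

theorem abs_lam_succ_sub_le (j : ℤ) : |L.lam (j + 1) - L.lam j| ≤ (L.e + 1) * L.o := by
  have hn := L.n_pos
  have ho := L.o_pos
  have he : 0 ≤ L.e := by linarith [L.e_eq, L.R_pos]
  have key : ∀ j, 0 ≤ j → j < L.n → |L.lam (j + 1) - L.lam j| ≤ (L.e + 1) * L.o := by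
    intro j h0 h1
    have hd : (j + 1 + 1) / L.n = (j + 1) / L.n ∨ (j + 1 + 1) / L.n = (j + 1) / L.n + 1 := by
      have h2 : (j + 1) / L.n ≤ (j + 1 + 1) / L.n := Int.ediv_le_ediv (by omega) (by omega)
      have h3 : (j + 1 + 1) / L.n ≤ (j + 1 + L.n * 1) / L.n :=
        Int.ediv_le_ediv (by omega) (by omega)
      rw [Int.add_mul_ediv_left _ _ (by omega)] at h3
      omega
    have hm : |min ((j + 1) % L.n) (L.n - 1 - (j + 1) % L.n) -
        min (j % L.n) (L.n - 1 - j % L.n)| ≤ 1 := by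
      rw [Int.emod_eq_of_lt h0 h1]
      rcases eq_or_ne j (L.n - 1) with rfl | h
      · rw [sub_add_cancel, Int.emod_self, abs_le]; omega
      · rw [Int.emod_eq_of_lt (by omega) (by omega), abs_le]; omega
    unfold lam
    set A := min ((j + 1) % L.n) (L.n - 1 - (j + 1) % L.n)
    set B := min (j % L.n) (L.n - 1 - j % L.n)
    rw [← mul_sub, abs_mul, abs_of_pos (by omega), mul_comm]
    gcongr
    rw [abs_le] at hm ⊢
    constructor <;> rcases hd with hd | hd <;> rw [hd] <;> nlinarith
  have hj := Int.emod_add_mul_ediv j L.n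
  have := key (j % L.n) (Int.emod_nonneg _ (by omega)) (Int.emod_lt_of_pos _ (by omega))
  have e1 := L.lam_add (j % L.n) (j / L.n)
  have e2 := L.lam_add (j % L.n + 1) (j / L.n)
  rw [hj] at e1
  rw [add_right_comm, hj] at e2
  rw [e1, e2]
  simpa using this

theorem lev_shift (A : Pos → ℤ → Prop) (v : Pos) (z y : ℤ) :
    L.lev (fun u i => A (u - v) i) (z + (L.w * v.1 - L.o * v.2)) (y + L.s * v.2) =
      L.lev A z y + L.n * v.2 := by
  have hm := L.m_pos
  unfold lev
  rw [push_shift, add_sub_right_comm, L.s_eq_mul, mul_assoc,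
    Int.add_mul_ediv_left _ _ (by omega)]

theorem zeta_shift (v p : Pos) :
    L.zeta (sc L.s v + p) = L.zeta p + (L.w * v.1 - L.o * v.2) := by
  have hq := L.q_pos
  unfold zeta sc
  simp only [Prod.fst_add, Prod.snd_add]
  have h1 : (L.s * v.2 + p.2 + 1) / L.q = (p.2 + 1) / L.q + 2 * L.o * v.2 := by
    rw [← Int.add_mul_ediv_left _ _ (by omega : L.q ≠ 0), L.s_eq, L.w_eq]
    ring_nf
  rw [h1, ← Int.add_mul_ediv_left _ _ two_ne_zero, L.s_eq]
  ring_nf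

/-- Translating the active tubes translates the cells. -/
theorem cell_shift (A : Pos → ℤ → Prop) (v p : Pos) :
    L.cell (fun u i => A (u - v) i) (sc L.s v + p) = v + L.cell A p := by
  have hw := L.w_pos
  have hn := L.n_pos
  have h2 : (sc L.s v + p).2 = p.2 + L.s * v.2 := by simp [sc, add_comm]
  unfold cell
  rw [L.zeta_shift, h2, L.lev_shift, L.lam_add]
  ext
  · simp only [Prod.fst_add]
    rw [add_comm v.1, ← Int.add_mul_ediv_left _ _ (by omega : L.w ≠ 0)]
    congr 1
    ring
  · simp only [Prod.snd_add]
    rw [add_comm v.2, Int.add_mul_ediv_left _ _ (by omega : L.n ≠ 0)]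

theorem monotone_sub_push (A : Pos → ℤ → Prop) (z : ℤ) :
    Monotone fun y => y - L.push A z y := by
  refine monotone_int_of_le_succ fun y => ?_
  have := L.push_lipschitz A (z := z) (z' := z) (y := y + 1) (y' := y) (c := 1) (by simp)
    (by simp)
  linarith

theorem exists_lev_eq (A : Pos → ℤ → Prop) (z j : ℤ) :
    ∃ y, L.lev A z y = j ∧ L.lev A (z + 1) y = j := by
  have hS := L.S_big
  have hm := L.m_eq
  have hex : ∃ y, L.m * j ≤ y - L.push A z y ∧ L.m * j ≤ y - L.push A (z + 1) y :=
    ⟨L.m * j + L.S * L.W, by linarith [L.push_le A z (L.m * j + L.S * L.W)],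
      by linarith [L.push_le A (z + 1) (L.m * j + L.S * L.W)]⟩
  obtain ⟨y, ⟨h1, h2⟩, hmin⟩ := Int.exists_least_of_bdd
    (P := fun y => L.m * j ≤ y - L.push A z y ∧ L.m * j ≤ y - L.push A (z + 1) y)
    ⟨L.m * j, fun y hy => by linarith [L.push_nonneg A z y]⟩ hex
  have hlt : ¬ (L.m * j ≤ y - 1 - L.push A z (y - 1) ∧
      L.m * j ≤ y - 1 - L.push A (z + 1) (y - 1)) := fun h => by
    have := hmin _ h
    omega
  have v1 := L.push_lipschitz A (z := z) (z' := z) (y := y - 1) (y' := y) (c := 1)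
    (by simp) (by simp)
  have v2 := L.push_lipschitz A (z := z + 1) (z' := z + 1) (y := y - 1) (y' := y) (c := 1)
    (by simp) (by simp)
  have h12 := L.push_lipschitz A (z := z) (z' := z + 1) (y := y) (y' := y) (c := L.S)
    (by simp) (by simp; omega)
  have h21 := L.push_lipschitz A (z := z + 1) (z' := z) (y := y) (y' := y) (c := L.S)
    (by simp) (by simp; omega)
  refine ⟨y, ?_, ?_⟩ <;> unfold lev <;>
    refine (Int.ediv_eq_iff_of_pos (by omega)).mpr ⟨?_, ?_⟩ <;>
    rw [not_and_or, not_le, not_le] at hlt <;> rcases hlt with h | h <;> nlinarith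

theorem connectedDom_singleton (u : Pos) : ConnectedDom {u} := by
  rw [connectedDom_iff]
  rintro p rfl q rfl
  exact .refl

/-- Cells are connected. -/
theorem connectedDom_cell (A : Pos → ℤ → Prop) (u : Pos) :
    ConnectedDom {p | L.cell A p = u} := by
  have hw := L.w_pos
  have hn := L.n_pos
  have hm := L.m_pos
  have hq := L.q_pos
  have h1 := connectedDom_preimage_column (fun _ j => j / L.n)
    (fun _ a b hab => Int.ediv_le_ediv (by omega) hab)
    (fun _ j => ⟨L.n * j, Int.mul_ediv_cancel_left _ (by omega),
      Int.mul_ediv_cancel_left _ (by omega)⟩) (connectedDom_singleton u)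
  have h2 := connectedDom_preimage_row (fun j z => (z - L.lam j) / L.w)
    (fun _ a b hab => Int.ediv_le_ediv (by omega) (by omega))
    (fun j a => by
      have h := L.abs_lam_succ_sub_le j
      have h' := L.e_succ_mul_o_lt
      rw [abs_le] at h
      refine ⟨L.w * a + max (L.lam j) (L.lam (j + 1)), ?_, ?_⟩ <;>
        refine (Int.ediv_eq_iff_of_pos (by omega)).mpr ⟨?_, ?_⟩ <;>
        rcases le_total (L.lam j) (L.lam (j + 1)) with h3 | h3 <;> simp [h3] <;> nlinarith) h1
  have h3 := connectedDom_preimage_column (fun z y => L.lev A z y)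
    (fun z a b hab => Int.ediv_le_ediv (by omega) (L.monotone_sub_push A z hab))
    (L.exists_lev_eq A) h2
  have h4 := connectedDom_preimage_row (fun y x => (x - (y + 1) / L.q) / 2)
    (fun _ a b hab => Int.ediv_le_ediv (by omega) (by omega))
    (fun y a => by
      have h2 : (y + 1) / L.q ≤ (y + 1 + 1) / L.q := Int.ediv_le_ediv (by omega) (by omega)
      have h3 : (y + 1 + 1) / L.q ≤ (y + 1 + L.q * 1) / L.q :=
        Int.ediv_le_ediv (by omega) (by omega)
      rw [Int.add_mul_ediv_left _ _ (by omega)] at h3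
      exact ⟨2 * a + (y + 1 + 1) / L.q, by omega, by omega⟩) h3
  exact h4

theorem cell_zero (A : Pos → ℤ → Prop) : L.cell A (0, 0) = 0 := by
  have hq := L.q_pos
  have hw := L.w_pos
  have hm := L.m_pos
  have hn := L.n_pos
  have hz : L.zeta (0, 0) = 0 := by
    simp [zeta, Int.ediv_eq_zero_of_lt (show (0 : ℤ) ≤ 1 by omega) (show 1 < L.q by omega)]
  have hp : L.push A 0 0 = 0 :=
    L.push_eq_zero_of_corner A (v := 0) (Y := 0) (a := 0) (.inl rfl) (by simp; omega)
      (by simp; omega) (by simp)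
  have hl := L.lam_of_lt le_rfl (by omega)
  unfold cell lev
  simp [hz, hp, hl]

theorem cell_right (A : Pos → ℤ → Prop) : L.cell A (L.s - 1, 0) = 0 := by
  have hq := L.q_pos
  have hw := L.w_pos
  have hm := L.m_pos
  have hn := L.n_pos
  have hs := L.s_eq
  have hz : L.zeta (L.s - 1, 0) = L.w - 1 := by
    simp only [zeta, zero_add,
      Int.ediv_eq_zero_of_lt (show (0 : ℤ) ≤ 1 by omega) (show 1 < L.q by omega)]
    omega
  have hp : L.push A (L.w - 1) 0 = 0 :=
    L.push_eq_zero_of_corner A (v := 0) (Y := 0) (a := 1) (.inl rfl) (by simp; omega)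
      (by simp; omega) (by simp)
  have hl := L.lam_of_lt le_rfl (by omega)
  unfold cell lev
  simp [hz, hp, hl]
  exact Int.ediv_eq_zero_of_lt (by omega) (by omega)

theorem cell_top (A : Pos → ℤ → Prop) : L.cell A (0, L.s - 1) = 0 := by
  have hq := L.q_pos
  have hw := L.w_pos
  have hm := L.m_pos
  have hn := L.n_pos
  have hs := L.s_pos
  have hz : L.zeta (0, L.s - 1) = -L.o := by
    have : L.s = L.q * (2 * L.o) := by rw [L.s_eq, L.w_eq]; ring
    simp only [zeta, sub_add_cancel, this, Int.mul_ediv_cancel_left _ (show L.q ≠ 0 by omega)]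
    omega
  have hp : L.push A (-L.o) (L.s - 1) = 0 :=
    L.push_eq_zero_of_corner A (v := L.s - 1) (Y := 1) (a := 0) (.inl rfl) (by simp; omega)
      (by simp; omega) (by simp)
  have hl := L.lam_mul_sub_one 1
  have hd : (L.s - 1) / L.m = L.n * 1 - 1 := by
    rw [Int.ediv_eq_iff_of_pos (by omega), L.s_eq_mul]
    constructor <;> nlinarith
  unfold cell lev
  simp only [hz, hp, sub_zero, hd, hl]
  simp
  exact Int.ediv_eq_zero_of_lt (by omega) (by omega)

theorem cell_sc (A : Pos → ℤ → Prop) (v : Pos) : L.cell A (sc L.s v) = v := by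
  have h := L.cell_shift (fun u i => A (u + v) i) v (0, 0)
  rw [L.cell_zero] at h
  simpa [← Prod.zero_eq_mk] using h

theorem zeta_step {p p' : Pos} (h : p' = p + (1, 0) ∨ p' = p + (0, 1)) :
    |L.zeta p' - L.zeta p| ≤ 1 ∧ |p'.2 - p.2| ≤ 1 := by
  have hq := L.q_pos
  have h2 : (p.2 + 1) / L.q ≤ (p.2 + 1 + 1) / L.q := Int.ediv_le_ediv (by omega) (by omega)
  have h3 : (p.2 + 1 + 1) / L.q ≤ (p.2 + 1 + L.q * 1) / L.q :=
    Int.ediv_le_ediv (by omega) (by omega)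
  rw [Int.add_mul_ediv_left _ _ (by omega)] at h3
  unfold zeta
  rcases h with rfl | rfl
  · simp only [Prod.fst_add, Prod.snd_add, add_zero, abs_le]
    omega
  · simp only [Prod.fst_add, Prod.snd_add, add_zero, abs_le]
    omega

/-- A wall between rows is never crossed where a column changes. -/
theorem col_eq_of_lev_succ {A : Pos → ℤ → Prop} {p p' : Pos} {Y : ℤ}
    (h : p' = p + (1, 0) ∨ p' = p + (0, 1) ∨ p = p' + (1, 0) ∨ p = p' + (0, 1))
    (hj : L.lev A (L.zeta p) p.2 = L.n * Y - 1) (hj' : L.lev A (L.zeta p') p'.2 = L.n * Y) :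
    (L.cell A p).1 = (L.cell A p').1 := by
  have hw := L.w_pos
  have hm := L.m_pos
  have hq := L.q_pos
  have hs := L.s_pos
  have hz : |L.zeta p' - L.zeta p| ≤ 1 := by
    rcases h with h | h | h | h
    · exact (L.zeta_step (.inl h)).1
    · exact (L.zeta_step (.inr h)).1
    · rw [abs_sub_comm]; exact (L.zeta_step (.inl h)).1
    · rw [abs_sub_comm]; exact (L.zeta_step (.inr h)).1
  unfold cell
  simp only [hj, hj', L.lam_mul, L.lam_mul_sub_one, sub_neg_eq_add]
  by_contra hne
  set z := L.zeta p with hzdef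
  set z' := L.zeta p' with hzdef'
  have e1 := Int.emod_add_mul_ediv (z + L.o * Y) L.w
  have e2 := Int.emod_add_mul_ediv (z' + L.o * Y) L.w
  have l1 := Int.emod_nonneg (z + L.o * Y) (show L.w ≠ 0 by omega)
  have l2 := Int.emod_nonneg (z' + L.o * Y) (show L.w ≠ 0 by omega)
  have u1 := Int.emod_lt_of_pos (z + L.o * Y) (show 0 < L.w by omega)
  have u2 := Int.emod_lt_of_pos (z' + L.o * Y) (show 0 < L.w by omega)
  have hcol : ∃ a, (z + L.o * Y = L.w * a ∨ z + L.o * Y = L.w * a - 1) ∧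
      (z' + L.o * Y = L.w * a ∨ z' + L.o * Y = L.w * a - 1) := by
    rw [abs_le] at hz
    rcases lt_or_gt_of_ne hne with hlt | hlt
    · refine ⟨(z' + L.o * Y) / L.w, ?_⟩
      have : L.w * ((z + L.o * Y) / L.w) + L.w ≤ L.w * ((z' + L.o * Y) / L.w) := by nlinarith
      omega
    · refine ⟨(z + L.o * Y) / L.w, ?_⟩
      have : L.w * ((z' + L.o * Y) / L.w) + L.w ≤ L.w * ((z + L.o * Y) / L.w) := by nlinarith
      omega
  obtain ⟨a, ha, ha'⟩ := hcol
  unfold lev at hj hj'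
  rw [Int.ediv_eq_iff_of_pos (by omega)] at hj hj'
  have hsY : L.s * Y = L.m * (L.n * Y) := by rw [L.s_eq_mul]; ring
  have hp : L.push A z p.2 = 0 := L.push_eq_zero_of_corner A (.inr rfl)
    (by nlinarith) (by nlinarith) ha
  have hp' : L.push A z' p'.2 = 0 := L.push_eq_zero_of_corner A (.inr rfl)
    (by nlinarith) (by nlinarith) ha'
  rw [hp] at hj
  rw [hp'] at hj'
  have hlt : p.2 < L.s * Y := by nlinarith
  have hle : L.s * Y ≤ p'.2 := by nlinarith
  have hqs : L.s * Y = L.q * (2 * L.o * Y) := by rw [L.s_eq, L.w_eq]; ring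
  have hup : p' = p + (0, 1) := by
    rcases h with h | h | h | h
    · rw [h] at hle; simp at hle; omega
    · exact h
    · rw [h] at hlt; simp at hlt; omega
    · rw [h] at hlt; simp at hlt; omega
  apply hne
  have hzz : z' = z := by
    rw [hzdef, hzdef', hup]
    rw [hup] at hle
    simp only [Prod.snd_add] at hle
    have hpy : p.2 + 1 = L.q * (2 * L.o * Y) := by omega
    unfold zeta
    simp only [Prod.fst_add, Prod.snd_add, add_zero, hpy]
    rw [Int.mul_ediv_cancel_left _ (by omega : L.q ≠ 0), add_comm (L.q * _) 1,
      Int.add_mul_ediv_left _ _ (by omega : L.q ≠ 0),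
      Int.ediv_eq_zero_of_lt (by omega : (0 : ℤ) ≤ 1) (by omega), zero_add]
  rw [hzz]

theorem abs_ediv_sub_ediv_le {a b c : ℤ} (hc : 0 < c) (h : |a - b| ≤ c) :
    |a / c - b / c| ≤ 1 := by
  rw [abs_le] at h ⊢
  have h1 : a / c ≤ (b + c * 1) / c := Int.ediv_le_ediv hc (by omega)
  have h2 : b / c ≤ (a + c * 1) / c := Int.ediv_le_ediv hc (by omega)
  rw [Int.add_mul_ediv_left _ _ (by omega)] at h1 h2
  omega

/-- Neighboring points lie in the same cell or in neighboring cells. -/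
theorem cell_step (A : Pos → ℤ → Prop) {p p' : Pos}
    (h : p' = p + (1, 0) ∨ p' = p + (0, 1)) :
    L.cell A p' = L.cell A p ∨ L.cell A p' - L.cell A p ∈ Nvn := by
  have hw := L.w_pos
  have hm := L.m_eq
  have hS := L.S_big
  have hn := L.n_pos
  obtain ⟨hz, hy⟩ := L.zeta_step h
  have hlev : |L.lev A (L.zeta p') p'.2 - L.lev A (L.zeta p) p.2| ≤ 1 := by
    refine abs_ediv_sub_ediv_le (by omega) ?_
    have h1 := L.push_lipschitz A (z := L.zeta p) (z' := L.zeta p') (y := p.2) (y' := p'.2)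
      (c := L.S) (by nlinarith) (by omega)
    have h2 := L.push_lipschitz A (z := L.zeta p') (z' := L.zeta p) (y := p'.2) (y' := p.2)
      (c := L.S) (by rw [abs_sub_comm]; nlinarith) (by rw [abs_sub_comm]; omega)
    rw [abs_le] at hy ⊢
    omega
  have hlam : |L.lam (L.lev A (L.zeta p') p'.2) - L.lam (L.lev A (L.zeta p) p.2)| ≤
      (L.e + 1) * L.o := by
    have h0 : 0 ≤ (L.e + 1) * L.o := (abs_nonneg _).trans (L.abs_lam_succ_sub_le 0)
    generalize L.lev A (L.zeta p') p'.2 = j' at *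
    generalize L.lev A (L.zeta p) p.2 = j at *
    rw [abs_le] at hlev
    obtain h | h | h : j' = j ∨ j' = j + 1 ∨ j = j' + 1 := by omega
    · simpa [h] using h0
    · rw [h]; exact L.abs_lam_succ_sub_le j
    · rw [h, abs_sub_comm]; exact L.abs_lam_succ_sub_le j'
  have hcol : |(L.cell A p').1 - (L.cell A p).1| ≤ 1 := by
    refine abs_ediv_sub_ediv_le (by omega) ?_
    have h' := L.e_succ_mul_o_lt
    rw [abs_le] at hz hlam ⊢
    constructor <;> linarith
  have hrow : |(L.cell A p').2 - (L.cell A p).2| ≤ 1 :=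
    abs_ediv_sub_ediv_le (by omega) (by omega)
  have hor : (L.cell A p').2 = (L.cell A p).2 ∨ (L.cell A p').1 = (L.cell A p).1 := by
    have hwall : ∀ j, (j + 1) / L.n ≠ j / L.n → j = L.n * ((j + 1) / L.n) - 1 := by
      intro j hj
      have e1 := Int.emod_add_mul_ediv j L.n
      have e2 := Int.emod_add_mul_ediv (j + 1) L.n
      have l1 := Int.emod_nonneg j (show L.n ≠ 0 by omega)
      have l2 := Int.emod_nonneg (j + 1) (show L.n ≠ 0 by omega)
      have u1 := Int.emod_lt_of_pos j (show 0 < L.n by omega)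
      have hlt : j / L.n < (j + 1) / L.n :=
        lt_of_le_of_ne (Int.ediv_le_ediv (by omega) (by omega)) (Ne.symm hj)
      nlinarith
    by_contra hne
    rw [not_or] at hne
    obtain ⟨hr, hc⟩ := hne
    rw [abs_le] at hlev
    obtain hj | hj | hj : L.lev A (L.zeta p') p'.2 = L.lev A (L.zeta p) p.2 ∨
      L.lev A (L.zeta p') p'.2 = L.lev A (L.zeta p) p.2 + 1 ∨
      L.lev A (L.zeta p) p.2 = L.lev A (L.zeta p') p'.2 + 1 := by omega
    · exact hr (by simp only [cell, hj])
    · have := hwall (L.lev A (L.zeta p) p.2) (by rw [← hj]; exact hr)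
      exact hc (L.col_eq_of_lev_succ (by tauto) this (by omega)).symm
    · have := hwall (L.lev A (L.zeta p') p'.2) (by rw [← hj]; exact Ne.symm hr)
      exact hc (L.col_eq_of_lev_succ (by tauto) this (by omega))
  simp only [Nvn, Set.mem_insert_iff, Set.mem_singleton_iff, Prod.ext_iff, Prod.fst_sub,
    Prod.snd_sub]
  rw [abs_le] at hcol hrow
  omega

theorem cell_step_of_sub_mem (A : Pos → ℤ → Prop) {p p' : Pos} (h : p' - p ∈ Nvn) :
    L.cell A p' = L.cell A p ∨ L.cell A p' - L.cell A p ∈ Nvn := by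
  simp only [Nvn, Set.mem_insert_iff, Set.mem_singleton_iff] at h
  have rev : (p = p' + (1, 0) ∨ p = p' + (0, 1)) →
      L.cell A p' = L.cell A p ∨ L.cell A p' - L.cell A p ∈ Nvn := fun h => by
    rcases L.cell_step A h with h | h
    · exact .inl h.symm
    · exact .inr (by simpa using neg_mem_Nvn h)
  rcases h with h | h | h | h
  · exact L.cell_step A (.inr (by rw [← h]; abel))
  · exact L.cell_step A (.inl (by rw [← h]; abel))
  · refine rev (.inr ?_)
    have := sub_eq_iff_eq_add'.mp h
    rw [this]; ext <;> simp
  · refine rev (.inl ?_)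
    have := sub_eq_iff_eq_add'.mp h
    rw [this]; ext <;> simp

theorem finite_cell_zero (A : Pos → ℤ → Prop) : {p | L.cell A p = 0}.Finite := by
  have hw := L.w_pos
  have hm := L.m_pos
  have hn := L.n_pos
  have hq := L.q_pos
  obtain ⟨B, hB⟩ : ∃ B, ∀ j ∈ Set.Ico 0 L.n, |L.lam j| ≤ B := by
    obtain ⟨B, hB⟩ := ((Set.finite_Ico 0 L.n).image fun j => |L.lam j|).bddAbove
    exact ⟨B, fun j hj => hB ⟨j, hj, rfl⟩⟩
  have hB0 : 0 ≤ B := (abs_nonneg _).trans (hB 0 ⟨le_rfl, by omega⟩)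
  set C := 2 * (B + L.w) + L.m * L.n + L.S * L.W + 2
  refine ((Set.finite_Icc (-C) C).prod (Set.finite_Icc (-C) C)).subset ?_
  rintro ⟨x, y⟩ hp
  have h1 : (L.cell A (x, y)).1 = 0 := by rw [hp]; rfl
  have h2 : (L.cell A (x, y)).2 = 0 := by rw [hp]; rfl
  have hn0 := L.push_nonneg A (L.zeta (x, y)) y
  have hn1 := L.push_le A (L.zeta (x, y)) y
  simp only [cell] at h1 h2
  rw [Int.ediv_eq_iff_of_pos (by omega)] at h1 h2
  have hb := hB (L.lev A (L.zeta (x, y)) y) ⟨by omega, by omega⟩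
  rw [abs_le] at hb
  obtain ⟨g1, g2⟩ : 0 ≤ y - L.push A (L.zeta (x, y)) y ∧
      y - L.push A (L.zeta (x, y)) y < L.m * L.n := by
    have e1 := Int.emod_add_mul_ediv (y - L.push A (L.zeta (x, y)) y) L.m
    have l1 := Int.emod_nonneg (y - L.push A (L.zeta (x, y)) y) (show L.m ≠ 0 by omega)
    have u1 := Int.emod_lt_of_pos (y - L.push A (L.zeta (x, y)) y) (show 0 < L.m by omega)
    unfold lev at h2
    constructor <;> nlinarith
  have hy0 : 0 ≤ (y + 1) / L.q := Int.ediv_nonneg (by omega) (by omega)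
  have hy1 : (y + 1) / L.q ≤ y + 1 := Int.ediv_le_self _ (by omega)
  have hz : L.zeta (x, y) = (x - (y + 1) / L.q) / 2 := rfl
  have hmn : 0 ≤ L.m * L.n := by positivity
  simp only [Set.mem_prod, Set.mem_Icc]
  omega

/-- The tube of tile number `i` belongs to the cell of the origin when it is active and to
the cell `v` otherwise. -/
theorem exists_cell_conflict {A B : Pos → ℤ → Prop} {i : ℤ} (hi : 0 ≤ i) (hiK : i < L.K)
    (hA : A 0 i) (hB : ¬ B 0 i) {v : Pos} (h1 : |v.1| ≤ L.R) (h2 : v.2 ≤ L.R)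
    (hv : 0 < v.2 ∨ v.2 = 0 ∧ v.1 < 0) : ∃ p, L.cell A p = 0 ∧ L.cell B p = v := by
  have hR := L.R_pos
  have hw := L.w_pos
  have hm := L.m_pos
  have hn := L.n_eq
  have hs := L.s_eq_mul
  have hS := L.S_big
  have hW := L.W_pos
  have ho := L.o_eq
  obtain ⟨a, b⟩ := v
  simp only at h1 h2 hv
  rw [abs_le] at h1
  set z := L.center 0 i with hz
  set y := L.m * (2 * (L.R - a) + L.n * b) with hy
  have hzp : L.zeta (2 * z + (y + 1) / L.q, y) = z := by unfold zeta; simp only; omega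
  have hfoot : L.foot 0 = L.m * (2 * L.R) := by simp [foot]; ring
  have hyf : y - L.foot 0 = L.m * (L.n * b - 2 * a) := by rw [hy, hfoot]; ring
  have hpos : 0 < L.n * b - 2 * a := by
    rcases hv with hv | ⟨rfl, hv⟩
    · nlinarith
    · simp; omega
  have hle : L.n * b - 2 * a ≤ (L.R + 1) * L.n := by nlinarith
  have hfy : L.foot 0 < y := by nlinarith
  have hyle : y - L.foot 0 ≤ L.S * L.W := by
    rw [hyf, L.S_mul_W, hs]; nlinarith
  have hSW : 0 < L.S * L.W := by positivity
  have hroof : L.roof 0 i z y = y - L.foot 0 := by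
    unfold roof
    rw [hz]
    simp only [sub_self, abs_zero, mul_zero]
    rw [max_eq_right (abs_nonneg _), abs_of_nonpos (by omega)]
    ring
  refine ⟨(2 * z + (y + 1) / L.q, y), ?_, ?_⟩
  · have hlev : L.lev A z y = 2 * L.R := by
      unfold lev
      rw [L.push_eq_roof hA hi hiK (by omega), hroof, sub_sub_cancel, hfoot,
        Int.mul_ediv_cancel_left _ (by omega)]
    have hlam : L.lam (2 * L.R) = L.R * L.w := by
      rw [L.lam_of_lt (by omega) (by omega), L.w_eq, L.q_eq]; ring
    have hi2 : 2 * L.W * i ≤ L.o - 2 * L.W := by rw [ho]; nlinarith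
    have how : L.o ≤ L.w := by rw [L.w_eq']; nlinarith [L.o_pos]
    have hi0 : 0 ≤ 2 * L.W * i := by positivity
    have hc : z = L.R * L.w + 2 * L.W * i + L.W := by simp [hz, center]
    unfold cell
    simp only [hzp, hlev, hlam]
    ext
    · simp only [Prod.fst_zero]
      exact Int.ediv_eq_zero_of_lt (by omega) (by omega)
    · simp only [Prod.snd_zero]
      exact Int.ediv_eq_zero_of_lt (by omega) (by omega)
  · have hpush : L.push B z y = 0 := by
      refine L.push_eq_zero fun u k hu hk hkK => ?_
      by_contra hr
      obtain ⟨e1, e2⟩ := L.roof_pos_unique hk hkK hi hiK (not_le.mp hr)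
        (show 0 < L.roof 0 i z y by omega)
      exact hB (by rwa [e1, e2] at hu)
    have hlev : L.lev B z y = 2 * (L.R - a) + L.n * b := by
      unfold lev
      rw [hpush, sub_zero, hy, Int.mul_ediv_cancel_left _ (by omega)]
    have hlam : L.lam (2 * (L.R - a) + L.n * b) = L.R * L.w - L.w * a - L.o * b := by
      rw [L.lam_add, L.lam_of_lt (by omega) (by omega), L.w_eq, L.q_eq]; ring
    have hb0 : 0 ≤ b := by omega
    have hi2 : 2 * L.W * i ≤ L.o - 2 * L.W := by rw [ho]; nlinarith
    have hi0 : 0 ≤ 2 * L.W * i := by positivity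
    have hob0 : 0 ≤ L.o * b := by have := L.o_pos; positivity
    have hob1 : L.o * b + L.o ≤ L.w := by rw [L.w_eq']; nlinarith [L.o_pos]
    have hc : z = L.R * L.w + 2 * L.W * i + L.W := by simp [hz, center]
    unfold cell
    simp only [hzp, hlev, hlam]
    ext
    · simp only
      refine (Int.ediv_eq_iff_of_pos (by omega)).mpr ⟨?_, ?_⟩ <;> nlinarith
    · simp only
      rw [Int.add_mul_ediv_left _ _ (by omega), Int.ediv_eq_zero_of_lt (by omega) (by omega),
        zero_add]

end Layout

section Blob

variable {X : Type} {N : Set Pos}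

/-- The polyomino of shape `D` whose inner edges are labelled by `t`. -/
noncomputable def blob (D : Set Pos) (t : Tile X N) :
    Pos → Option (Tile (Option (Tile X N)) Nvn) :=
  fun p => if p ∈ D then some fun w => if p + w.1 ∈ D then some t else none else none

theorem blob_ne_none {D : Set Pos} {t : Tile X N} {p : Pos} : blob D t p ≠ none ↔ p ∈ D := by
  unfold blob
  split_ifs with h <;> simp [h]

theorem blob_eq_some {D : Set Pos} {t : Tile X N} {p : Pos}
    {a : Tile (Option (Tile X N)) Nvn} (h : blob D t p = some a) :
    p ∈ D ∧ ∀ w, a w = if p + w.1 ∈ D then some t else none := by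
  unfold blob at h
  split_ifs at h with hp
  cases h
  exact ⟨hp, fun _ => rfl⟩

theorem isTiling_blob (D : Set Pos) (t : Tile X N) : IsTiling Set.univ (blob D t) := by
  refine ⟨fun _ _ _ => Set.mem_univ _, fun p a ha w b hb hw hw' => ?_⟩
  obtain ⟨hp, ha⟩ := blob_eq_some ha
  obtain ⟨hpw, hb⟩ := blob_eq_some hb
  simp [ha, hb, hp, hpw]

/-- When the polyominoes of two shapes occur in a tiling and share a position, the first one,
if connected, is contained in the second one. -/
theorem mem_of_blob_overlap {D D' : Set Pos} {t t' : Tile X N} {c c' p p' : Pos}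
    {τ' : Pos → Option (Tile (Option (Tile X N)) Nvn)} (hD : ConnectedDom D)
    (h : ∀ q a, blob D t q = some a → τ' (c + q) = some a)
    (h' : ∀ q a, blob D' t' q = some a → τ' (c' + q) = some a)
    (hp : p ∈ D) (hp' : p' ∈ D') (hpp : c + p = c' + p') {q : Pos} (hq : q ∈ D) :
    c + q - c' ∈ D' := by
  have hj := connectedDom_iff.mp hD p hp q hq
  clear hq
  induction hj with
  | refl => rw [hpp]; simpa using hp'
  | @tail b d _ hbd ih =>
    obtain ⟨hb, hd, hv⟩ := hbd
    obtain ⟨a, ha⟩ := Option.ne_none_iff_exists'.mp (blob_ne_none (t := t).mpr hb)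
    obtain ⟨a', ha'⟩ := Option.ne_none_iff_exists'.mp (blob_ne_none (t := t').mpr ih)
    have e1 := h _ _ ha
    have e2 := h' _ _ ha'
    rw [add_sub_cancel, e1] at e2
    cases e2
    have g1 := (blob_eq_some ha).2 ⟨d - b, hv⟩
    have g2 := (blob_eq_some ha').2 ⟨d - b, hv⟩
    rw [g1] at g2
    simp only [add_sub_cancel, hd, if_true] at g2
    by_contra hne
    rw [show c + b - c' + (d - b) = c + d - c' by abel, if_neg hne] at g2
    cases g2

end Blob

section Simulation

variable {X : Type} {N : Set Pos} (L : Layout) (idx : Tile X N → ℤ) (T : Set (Tile X N))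

/-- The tubes activated by a tiling. -/
def active (τ : Pos → Option (Tile X N)) (u : Pos) (i : ℤ) : Prop :=
  ∃ t, τ u = some t ∧ idx t = i

/-- The shape of the tile at the origin of `τ`. -/
def shape (τ : Pos → Option (Tile X N)) : Set Pos := {p | L.cell (active idx τ) p = 0}

/-- The polyominoes representing `t`. -/
def assignment (t : Tile X N) : Set (Pos → Option (Tile (Option (Tile X N)) Nvn)) :=
  {σ | ∃ τ, IsTiling T τ ∧ τ (0, 0) = some t ∧ σ = blob (shape L idx τ) t}

/-- Occurrence of a polyomino at scaled position `u`. -/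
def Occurs {α : Type} (s : ℤ) (τ' σ : Pos → Option α) (u : Pos) : Prop :=
  ∀ p a, σ p = some a → τ' (sc s u + p) = some a

/-- The trimming map. -/
noncomputable def trim (τ' : Pos → Option (Tile (Option (Tile X N)) Nvn)) :
    Pos → Option (Pos → Option (Tile (Option (Tile X N)) Nvn)) := fun u =>
  if h : ∃ σ, (∃ t ∈ T, σ ∈ assignment L idx T t) ∧ Occurs L.s τ' σ u then some h.choose else none

/-- The poly-tilings simulating `τ`. -/
def simulations (τ : Pos → Option (Tile X N)) :
    Set (Pos → Option (Pos → Option (Tile (Option (Tile X N)) Nvn))) :=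
  {σ | IsPolyTiling Set.univ L.s σ ∧ (∀ u, σ u ≠ none ↔ τ u ≠ none) ∧
    ∀ u t, τ u = some t → ∀ σu, σ u = some σu → σu ∈ assignment L idx T t}

variable {L idx T}

theorem mem_shape_iff (τ : Pos → Option (Tile X N)) (u p : Pos) :
    p ∈ shape L idx (fun v => τ (v + u)) ↔ L.cell (active idx τ) (sc L.s u + p) = u := by
  have he : (fun v i => active idx (fun v => τ (v + u)) (v - u) i) = active idx τ := by
    funext v i
    simp [active]
  have h := L.cell_shift (active idx fun v => τ (v + u)) u p
  rw [he] at h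
  rw [h]
  simp [shape]

theorem sub_mem_shape_iff (τ : Pos → Option (Tile X N)) (u p : Pos) :
    p - sc L.s u ∈ shape L idx τ ↔ L.cell (fun v i => active idx τ (v - u) i) p = u := by
  have h := L.cell_shift (active idx τ) u (p - sc L.s u)
  rw [add_sub_cancel] at h
  rw [h]
  simp [shape]

theorem connectedDom_shape (τ : Pos → Option (Tile X N)) : ConnectedDom (shape L idx τ) :=
  L.connectedDom_cell _ 0

theorem zero_mem_shape (τ : Pos → Option (Tile X N)) : (0, 0) ∈ shape L idx τ :=
  L.cell_zero _

theorem isFiniteTiling_of_mem {t : Tile X N}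
    {σ : Pos → Option (Tile (Option (Tile X N)) Nvn)} (h : σ ∈ assignment L idx T t) :
    IsFiniteTiling Set.univ σ := by
  obtain ⟨τ, -, -, rfl⟩ := h
  refine ⟨isTiling_blob _ _, (L.finite_cell_zero (active idx τ)).subset fun p hp => ?_⟩
  exact blob_ne_none.mp hp

theorem ne_none_of_mem {t : Tile X N} {σ : Pos → Option (Tile (Option (Tile X N)) Nvn)}
    (h : σ ∈ assignment L idx T t) : σ (0, 0) ≠ none := by
  obtain ⟨τ, -, -, rfl⟩ := h
  exact blob_ne_none.mpr (zero_mem_shape τ)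

/-- The label of a polyomino can be read off each of its tiles. -/
theorem label_eq_of_mem {t t' : Tile X N}
    {σ σ' : Pos → Option (Tile (Option (Tile X N)) Nvn)} (h : σ ∈ assignment L idx T t)
    (h' : σ' ∈ assignment L idx T t') {p q : Pos} {a : Tile (Option (Tile X N)) Nvn}
    (hp : σ p = some a) (hq : σ' q = some a) : t = t' := by
  obtain ⟨τ, -, -, rfl⟩ := h
  obtain ⟨τ', -, -, rfl⟩ := h'
  obtain ⟨hp, ha⟩ := blob_eq_some hp
  obtain ⟨-, ha'⟩ := blob_eq_some hq
  have hs := L.s_pos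
  obtain ⟨r, hr, hne⟩ : ∃ r ∈ shape L idx τ, p ≠ r := by
    by_cases h0 : p = (0, 0)
    · refine ⟨(L.s - 1, 0), L.cell_right _, ?_⟩
      rw [h0]
      simp only [ne_eq, Prod.mk.injEq, and_true]
      omega
    · exact ⟨_, zero_mem_shape τ, h0⟩
  rcases (connectedDom_iff.mp (connectedDom_shape τ) p hp r hr).cases_head with h | ⟨d, hd, -⟩
  · exact absurd h hne
  · have e1 := ha ⟨d - p, hd.2.2⟩
    have e2 := ha' ⟨d - p, hd.2.2⟩
    rw [e1] at e2
    simp only [add_sub_cancel, hd.2.1, if_true] at e2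
    split_ifs at e2
    exact Option.some.inj e2

/-- Two polyominoes occurring in the same assembly do not overlap. -/
theorem eq_of_occurs_overlap {t t' : Tile X N}
    {τ' σ σ' : Pos → Option (Tile (Option (Tile X N)) Nvn)} (h : σ ∈ assignment L idx T t)
    (h' : σ' ∈ assignment L idx T t') {u u' p p' : Pos} (ho : Occurs L.s τ' σ u)
    (ho' : Occurs L.s τ' σ' u') (hp : σ p ≠ none) (hp' : σ' p' ≠ none)
    (hpp : sc L.s u + p = sc L.s u' + p') : u = u' := by
  obtain ⟨τ, -, -, rfl⟩ := h
  obtain ⟨τ₂, -, -, rfl⟩ := h'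
  have key := mem_of_blob_overlap (connectedDom_shape τ) ho ho' (blob_ne_none.mp hp)
    (blob_ne_none.mp hp') hpp (zero_mem_shape τ)
  have hsub : sc L.s u + (0, 0) - sc L.s u' = sc L.s (u - u') := by
    ext <;> simp [sc, mul_sub]
  rw [hsub] at key
  simp only [shape, Set.mem_ofPred_eq, L.cell_sc] at key
  exact sub_eq_zero.mp key

theorem trim_eq_some {τ' : Pos → Option (Tile (Option (Tile X N)) Nvn)} {u : Pos}
    {σ : Pos → Option (Tile (Option (Tile X N)) Nvn)} (h : trim L idx T τ' u = some σ) :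
    (∃ t ∈ T, σ ∈ assignment L idx T t) ∧ Occurs L.s τ' σ u := by
  unfold trim at h
  split_ifs at h with hex
  cases h
  exact hex.choose_spec

theorem isPolyTiling_trim {τ' : Pos → Option (Tile (Option (Tile X N)) Nvn)}
    (hτ' : IsTiling Set.univ τ') : IsPolyTiling Set.univ L.s (trim L idx T τ') := by
  refine ⟨fun u σ hσ => ?_, fun u v σ σ' huv hσ hσ' p hp q hq hpq => ?_,
    fun u u' σ σ' hσ hσ' v t hv v' t' hv' hw hw' => ?_⟩
  · obtain ⟨⟨t, -, ht⟩, -⟩ := trim_eq_some hσ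
    exact isFiniteTiling_of_mem ht
  · obtain ⟨⟨t, -, ht⟩, ho⟩ := trim_eq_some hσ
    obtain ⟨⟨t', -, ht'⟩, ho'⟩ := trim_eq_some hσ'
    exact huv (eq_of_occurs_overlap ht ht' ho ho' hp hq hpq)
  · obtain ⟨-, ho⟩ := trim_eq_some hσ
    obtain ⟨-, ho'⟩ := trim_eq_some hσ'
    exact hτ'.2 _ _ (ho _ _ hv) _ _ (by rw [add_sub_cancel]; exact ho' _ _ hv') hw _

/-- The canonical poly-tiling simulating `τ`. -/
noncomputable def canonical (L : Layout) (idx : Tile X N → ℤ) (τ : Pos → Option (Tile X N)) :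
    Pos → Option (Pos → Option (Tile (Option (Tile X N)) Nvn)) := fun u =>
  (τ u).map (blob (shape L idx fun v => τ (v + u)))

theorem canonical_eq_some {τ : Pos → Option (Tile X N)} {u : Pos}
    {σ : Pos → Option (Tile (Option (Tile X N)) Nvn)} (h : canonical L idx τ u = some σ) :
    ∃ t, τ u = some t ∧ σ = blob (shape L idx fun v => τ (v + u)) t := by
  obtain ⟨t, ht, rfl⟩ := Option.map_eq_some_iff.mp h
  exact ⟨t, ht, rfl⟩

theorem IsTiling.translate {τ : Pos → Option (Tile X N)} (hτ : IsTiling T τ) (u : Pos) :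
    IsTiling T fun v => τ (v + u) :=
  ⟨fun p t h => hτ.1 _ t h, fun p t h w t' h' => hτ.2 _ t h w t' (by
    rw [← h']; congr 1; abel)⟩

theorem canonical_mem {τ : Pos → Option (Tile X N)} (hτ : IsTiling T τ) :
    canonical L idx τ ∈ simulations L idx T τ := by
  have hassign : ∀ u σ t, τ u = some t → canonical L idx τ u = some σ →
      σ ∈ assignment L idx T t := by
    intro u σ t ht hσ
    obtain ⟨t', ht', rfl⟩ := canonical_eq_some hσ
    rw [ht] at ht'
    cases ht'
    exact ⟨_, hτ.translate u, by simpa [← Prod.zero_eq_mk] using ht, rfl⟩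
  refine ⟨⟨fun u σ hσ => ?_, fun u v σ σ' huv hσ hσ' p hp q hq hpq => ?_,
    fun u u' σ σ' hσ hσ' v a hv v' a' hv' hw hw' => ?_⟩, fun u => ?_,
    fun u t ht σ hσ => hassign u σ t ht hσ⟩
  · obtain ⟨t, ht, -⟩ := canonical_eq_some hσ
    exact isFiniteTiling_of_mem (hassign u σ t ht hσ)
  · obtain ⟨t, ht, rfl⟩ := canonical_eq_some hσ
    obtain ⟨t', ht', rfl⟩ := canonical_eq_some hσ'
    have h1 := (mem_shape_iff τ u p).mp (blob_ne_none.mp hp)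
    have h2 := (mem_shape_iff τ v q).mp (blob_ne_none.mp hq)
    rw [hpq, h2] at h1
    exact huv h1.symm
  · obtain ⟨t, ht, rfl⟩ := canonical_eq_some hσ
    obtain ⟨t', ht', rfl⟩ := canonical_eq_some hσ'
    obtain ⟨hv, ha⟩ := blob_eq_some hv
    obtain ⟨hv', ha'⟩ := blob_eq_some hv'
    rw [ha, ha', mem_shape_iff, mem_shape_iff]
    rw [mem_shape_iff] at hv hv'
    rw [show sc L.s u + (v + (sc L.s u' + v' - (sc L.s u + v))) = sc L.s u' + v' by abel,
      show sc L.s u' + (v' + -(sc L.s u' + v' - (sc L.s u + v))) = sc L.s u + v by abel, hv, hv']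
    by_cases huu : u = u'
    · subst huu
      rw [ht] at ht'
      simp [Option.some.inj ht']
    · simp [huu, Ne.symm huu]
  · simp [canonical]

/-- Hypotheses under which the layout simulates tilings. -/
structure Suitable (L : Layout) (idx : Tile X N → ℤ) : Prop where
  neighborhood : IsNeighborhood N
  injective : Function.Injective idx
  nonneg : ∀ t, 0 ≤ idx t
  lt : ∀ t, idx t < L.K
  bound : ∀ w ∈ N, |w.1| ≤ L.R ∧ |w.2| ≤ L.R

/-- Disjointness of two shapes means that each tile knows about the other. -/
theorem Suitable.eq_of_disjoint (hL : Suitable L idx) {τ₁ τ₂ : Pos → Option (Tile X N)}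
    {t : Tile X N} {w : Pos} (h₁ : τ₁ (0, 0) = some t) (hw : w ∈ N)
    (hpos : 0 < w.2 ∨ w.2 = 0 ∧ w.1 < 0)
    (hdisj : ∀ p ∈ shape L idx τ₁, p - sc L.s w ∉ shape L idx τ₂) : τ₂ (-w) = some t := by
  by_contra hne
  obtain ⟨p, hp, hp'⟩ := L.exists_cell_conflict (A := active idx τ₁)
    (B := fun v i => active idx τ₂ (v - w) i) (hL.nonneg t) (hL.lt t) ⟨t, h₁, rfl⟩
    (by
      rintro ⟨t', ht', he⟩
      rw [zero_sub, hL.injective he] at ht'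
      exact hne ht') (hL.bound w hw).1 (le_of_abs_le (hL.bound w hw).2) hpos
  exact hdisj p hp ((sub_mem_shape_iff τ₂ w p).mpr hp')

theorem Suitable.glue_eq (hL : Suitable L idx)
    {τ' σ σ' : Pos → Option (Tile (Option (Tile X N)) Nvn)} {t t' : Tile X N}
    (h : σ ∈ assignment L idx T t) (h' : σ' ∈ assignment L idx T t') {u w : Pos}
    (ho : Occurs L.s τ' σ u) (ho' : Occurs L.s τ' σ' (u + w)) (hw : w ∈ N) (hw' : -w ∈ N) :
    t ⟨w, hw⟩ = t' ⟨-w, hw'⟩ := by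
  have hw0 : w ≠ 0 := fun h0 => hL.neighborhood.2.1 (by rw [h0] at hw; exact hw)
  have hdisj : ∀ p q, σ p ≠ none → σ' q ≠ none → sc L.s u + p ≠ sc L.s (u + w) + q := by
    intro p q hp hq hpq
    have := eq_of_occurs_overlap h h' ho ho' hp hq hpq
    exact hw0 (by simpa using this)
  have hsc : ∀ v v' : Pos, sc L.s (v + v') = sc L.s v + sc L.s v' := by
    intro v v'
    ext <;> simp [sc, mul_add]
  have hsn : ∀ v : Pos, sc L.s (-v) = -sc L.s v := by
    intro v
    ext <;> simp [sc]
  obtain ⟨τ₁, hτ₁, h₁, rfl⟩ := h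
  obtain ⟨τ₂, hτ₂, h₂, rfl⟩ := h'
  by_cases hpos : 0 < w.2 ∨ w.2 = 0 ∧ w.1 < 0
  · have := hL.eq_of_disjoint (τ₂ := τ₂) h₁ hw hpos fun p hp hq => by
      refine hdisj p (p - sc L.s w) (blob_ne_none.mpr hp) (blob_ne_none.mpr hq) ?_
      rw [hsc]
      abel
    exact hτ₂.2 _ _ this w t' (by rw [neg_add_cancel]; exact h₂) hw hw'
  · have hpos' : 0 < (-w).2 ∨ (-w).2 = 0 ∧ (-w).1 < 0 := by
      have : ¬ (w.1 = 0 ∧ w.2 = 0) := fun h0 => hw0 (Prod.ext h0.1 h0.2)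
      simp only [Prod.snd_neg, Prod.fst_neg]
      omega
    have := hL.eq_of_disjoint (τ₂ := τ₁) h₂ hw' hpos' fun p hp hq => by
      refine hdisj (p - sc L.s (-w)) p (blob_ne_none.mpr hq) (blob_ne_none.mpr hp) ?_
      rw [hsc, hsn]
      abel
    rw [neg_neg] at this
    exact hτ₁.2 _ _ h₁ w t' (by rw [← Prod.zero_eq_mk, zero_add]; exact this) hw _

/-- The tiling recovered from an assembly. -/
noncomputable def recover (L : Layout) (idx : Tile X N → ℤ) (T : Set (Tile X N))
    (τ' : Pos → Option (Tile (Option (Tile X N)) Nvn)) : Pos → Option (Tile X N) := fun u =>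
  if h : ∃ t ∈ T, ∃ σ, trim L idx T τ' u = some σ ∧ σ ∈ assignment L idx T t then
    some h.choose else none

theorem recover_eq_some {τ' : Pos → Option (Tile (Option (Tile X N)) Nvn)} {u : Pos}
    {t : Tile X N} (h : recover L idx T τ' u = some t) :
    t ∈ T ∧ ∃ σ, trim L idx T τ' u = some σ ∧ σ ∈ assignment L idx T t := by
  unfold recover at h
  split_ifs at h with hex
  cases h
  exact hex.choose_spec

theorem recover_ne_none {τ' : Pos → Option (Tile (Option (Tile X N)) Nvn)} {u : Pos} :
    recover L idx T τ' u ≠ none ↔ trim L idx T τ' u ≠ none := by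
  constructor
  · intro h
    obtain ⟨t, ht⟩ := Option.ne_none_iff_exists'.mp h
    obtain ⟨-, σ, hσ, -⟩ := recover_eq_some ht
    simp [hσ]
  · intro h
    obtain ⟨σ, hσ⟩ := Option.ne_none_iff_exists'.mp h
    obtain ⟨⟨t, hT, ht⟩, -⟩ := trim_eq_some hσ
    rw [recover, dif_pos ⟨t, hT, σ, hσ, ht⟩]
    simp

theorem Suitable.existsUnique_recover (hL : Suitable L idx)
    {τ' : Pos → Option (Tile (Option (Tile X N)) Nvn)} (hτ' : IsTiling Set.univ τ') :
    ∃! τ, IsTiling T τ ∧ trim L idx T τ' ∈ simulations L idx T τ := by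
  refine ⟨recover L idx T τ', ⟨⟨fun p t h => (recover_eq_some h).1, ?_⟩,
    isPolyTiling_trim hτ', fun u => recover_ne_none.symm, fun u t ht σ hσ => ?_⟩, ?_⟩
  · intro p t ht w t' ht' hw hw'
    obtain ⟨-, σ, hσ, hm⟩ := recover_eq_some ht
    obtain ⟨-, σ', hσ', hm'⟩ := recover_eq_some ht'
    exact hL.glue_eq hm hm' (trim_eq_some hσ).2 (trim_eq_some hσ').2 hw hw'
  · obtain ⟨-, σ', hσ', hm⟩ := recover_eq_some ht
    rw [hσ] at hσ'
    cases hσ'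
    exact hm
  · rintro τ ⟨-, -, hdom, hcomp⟩
    funext u
    rcases hτu : τ u with _ | t
    · symm
      by_contra hne
      exact (hdom u).mp (recover_ne_none.mp hne) hτu
    · obtain ⟨σ, hσ⟩ := Option.ne_none_iff_exists'.mp ((hdom u).mpr (by simp [hτu]))
      obtain ⟨t', ht'⟩ := Option.ne_none_iff_exists'.mp
        (recover_ne_none.mpr (show trim L idx T τ' u ≠ none by simp [hσ]))
      obtain ⟨-, σ', hσ', hm'⟩ := recover_eq_some ht'
      rw [hσ] at hσ'
      cases hσ'
      have hm := hcomp u t hτu σ hσ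
      obtain ⟨a, ha⟩ := Option.ne_none_iff_exists'.mp (ne_none_of_mem hm)
      rw [ht', label_eq_of_mem hm hm' ha ha]

/-- The simulation given by a suitable layout. -/
noncomputable def Suitable.simulation (hL : Suitable L idx) (T : Set (Tile X N)) :
    TilingSimulation X (Option (Tile X N)) N T Set.univ L.s where
  hs := by have := L.s_pos; omega
  phi := assignment L idx T
  phi_fin := fun _ _ h => isFiniteTiling_of_mem h
  phi_ref := fun _ _ h => ne_none_of_mem h
  phi_spec := fun t t' htt σ hσ σ' hσ' p q a b ha hb hab => by
    subst hab
    exact htt (label_eq_of_mem hσ hσ' ha hb)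
  chi := trim L idx T
  chi_poly := fun _ h => isPolyTiling_trim h
  chi_sub := fun _ _ _ h => trim_eq_some h
  chi_max := fun τ' t ht σ hσ u h => by
    rw [trim, dif_pos ⟨σ, ⟨t, ht, hσ⟩, h⟩]
    simp
  psi := simulations L idx T
  psi_nonempty := fun _ h => ⟨_, canonical_mem h⟩
  psi_poly := fun _ _ _ h => h.1
  psi_dom := fun _ _ _ h => h.2.1
  psi_comp := fun _ _ _ h => h.2.2
  psi_recover := fun _ h => hL.existsUnique_recover h

theorem mem_tdom_induced {α : Type} {s : ℤ} {σ : Pos → Option (Pos → Option α)} {p : Pos} :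
    p ∈ tdom (induced s σ) ↔ ∃ u σu v, σ u = some σu ∧ σu v ≠ none ∧ p = sc s u + v := by
  simp only [tdom, Set.mem_ofPred_eq, induced]
  constructor
  · intro h
    split_ifs at h with hex
    · obtain ⟨t, u, σu, v, h1, h2, h3⟩ := hex
      exact ⟨u, σu, v, h1, by simp [h2], h3⟩
    · exact absurd rfl h
  · rintro ⟨u, σu, v, h1, h2, h3⟩
    obtain ⟨t, ht⟩ := Option.ne_none_iff_exists'.mp h2
    rw [dif_pos ⟨t, u, σu, v, h1, ht, h3⟩]
    simp

theorem finite_tdom_induced {α : Type} {s : ℤ} {σ : Pos → Option (Pos → Option α)}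
    (hσ : (tdom σ).Finite) (h : ∀ u σu, σ u = some σu → (tdom σu).Finite) :
    (tdom (induced s σ)).Finite := by
  have : (⋃ u ∈ tdom σ, ⋃ σu ∈ {x | σ u = some x}, (fun v => sc s u + v) '' tdom σu).Finite :=
    hσ.biUnion fun u _ => Set.Finite.biUnion
      (Set.Subsingleton.finite fun a ha b hb => Option.some.inj (ha.symm.trans hb))
      fun σu hσu => (h u σu hσu).image _
  refine this.subset fun p hp => ?_
  obtain ⟨u, σu, v, h1, h2, rfl⟩ := mem_tdom_induced.mp hp
  simp only [Set.mem_iUnion]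
  exact ⟨u, by simp [tdom, h1], σu, h1, v, h2, rfl⟩

/-- Simulations of connected tilings are connected. -/
theorem connectedDom_induced {τ : Pos → Option (Tile X N)} (hconn : ConnectedDom (tdom τ))
    {σ : Pos → Option (Pos → Option (Tile (Option (Tile X N)) Nvn))}
    (hσ : σ ∈ simulations L idx T τ) : ConnectedDom (tdom (induced L.s σ)) := by
  obtain ⟨-, hdom, hcomp⟩ := hσ
  set E := tdom (induced L.s σ) with hE
  have hshape : ∀ u, τ u ≠ none → ∃ (τ₁ : Pos → Option (Tile X N)) (t : Tile X N),
      σ u = some (blob (shape L idx τ₁) t) := by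
    intro u hu
    obtain ⟨t, ht⟩ := Option.ne_none_iff_exists'.mp hu
    obtain ⟨σu, hσu⟩ := Option.ne_none_iff_exists'.mp ((hdom u).mpr hu)
    obtain ⟨τ₁, -, -, rfl⟩ := hcomp u t ht σu hσu
    exact ⟨τ₁, t, hσu⟩
  have hcell : ∀ u (τ₁ : Pos → Option (Tile X N)) (t : Tile X N),
      σ u = some (blob (shape L idx τ₁) t) → ∀ p ∈ shape L idx τ₁,
      Joined E (sc L.s u) (sc L.s u + p) := by
    intro u τ₁ t hu p hp
    have hmem : ∀ q ∈ shape L idx τ₁, sc L.s u + q ∈ E := fun q hq =>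
      mem_tdom_induced.mpr ⟨u, _, q, hu, blob_ne_none.mpr hq, rfl⟩
    have := (connectedDom_iff.mp (connectedDom_shape τ₁) _ (zero_mem_shape τ₁) p hp).map
      (E := E) (fun q => sc L.s u + q) fun a b hab =>
        .single ⟨hmem a hab.1, hmem b hab.2.1, by simpa using hab.2.2⟩
    simpa [← Prod.zero_eq_mk] using this
  have hin : ∀ u, τ u ≠ none → sc L.s u ∈ E := by
    intro u hu
    obtain ⟨τ₁, t, h⟩ := hshape u hu
    exact mem_tdom_induced.mpr ⟨u, _, (0, 0), h, blob_ne_none.mpr (zero_mem_shape τ₁),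
      by simp [← Prod.zero_eq_mk]⟩
  have hnext : ∀ u v, τ u ≠ none → τ v ≠ none → (v = u + (1, 0) ∨ v = u + (0, 1)) →
      Joined E (sc L.s u) (sc L.s v) := by
    intro u v hu hv huv
    obtain ⟨τ₁, t, h⟩ := hshape u hu
    rcases huv with rfl | rfl
    · refine (hcell u τ₁ t h (L.s - 1, 0) (L.cell_right _)).tail ⟨?_, hin _ hv, ?_⟩
      · exact mem_tdom_induced.mpr ⟨u, _, _, h, blob_ne_none.mpr (L.cell_right _), rfl⟩
      · simp [Nvn, sc, mul_add]
    · refine (hcell u τ₁ t h (0, L.s - 1) (L.cell_top _)).tail ⟨?_, hin _ hv, ?_⟩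
      · exact mem_tdom_induced.mpr ⟨u, _, _, h, blob_ne_none.mpr (L.cell_top _), rfl⟩
      · simp [Nvn, sc, mul_add]
  have hstep : ∀ u v, Step (tdom τ) u v → Joined E (sc L.s u) (sc L.s v) := by
    rintro u v ⟨hu, hv, h⟩
    simp only [Nvn, Set.mem_insert_iff, Set.mem_singleton_iff] at h
    rcases h with h | h | h | h
    · exact hnext u v hu hv (.inr (by rw [← h]; abel))
    · exact hnext u v hu hv (.inl (by rw [← h]; abel))
    · refine (hnext v u hv hu (.inr ?_)).symm
      have := sub_eq_iff_eq_add'.mp h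
      rw [this]; ext <;> simp
    · refine (hnext v u hv hu (.inl ?_)).symm
      have := sub_eq_iff_eq_add'.mp h
      rw [this]; ext <;> simp
  rw [connectedDom_iff] at hconn ⊢
  intro p hp q hq
  have hbase : ∀ p ∈ E, ∃ u, τ u ≠ none ∧ Joined E (sc L.s u) p := by
    intro p hp
    obtain ⟨u, σu, v, h1, h2, rfl⟩ := mem_tdom_induced.mp hp
    have hu : τ u ≠ none := (hdom u).mp (by simp [h1])
    obtain ⟨τ₁, t, h⟩ := hshape u hu
    rw [h1] at h
    cases h
    exact ⟨u, hu, hcell u τ₁ t h1 v (blob_ne_none.mp h2)⟩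
  obtain ⟨u, hu, hup⟩ := hbase p hp
  obtain ⟨v, hv, hvq⟩ := hbase q hq
  exact hup.symm.trans (((hconn u hu v hv).map _ hstep).trans hvq)

/-- A tiling whose canonical simulation is connected is connected. -/
theorem connectedDom_of_canonical {τ : Pos → Option (Tile X N)}
    (h : ConnectedDom (tdom (induced L.s (canonical L idx τ)))) : ConnectedDom (tdom τ) := by
  have hmem : ∀ p, p ∈ tdom (induced L.s (canonical L idx τ)) ↔
      L.cell (active idx τ) p ∈ tdom τ := by
    intro p
    rw [mem_tdom_induced]
    constructor
    · rintro ⟨u, σu, v, h1, h2, rfl⟩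
      obtain ⟨t, ht, rfl⟩ := canonical_eq_some h1
      rw [(mem_shape_iff τ u v).mp (blob_ne_none.mp h2)]
      simp [tdom, ht]
    · intro hp
      obtain ⟨t, ht⟩ := Option.ne_none_iff_exists'.mp hp
      refine ⟨L.cell (active idx τ) p, _, p - sc L.s (L.cell (active idx τ) p),
        by rw [canonical, ht]; rfl, blob_ne_none.mpr ?_, by abel⟩
      rw [mem_shape_iff, add_sub_cancel]
  rw [connectedDom_iff] at h ⊢
  intro u hu v hv
  have := (h (sc L.s u) ((hmem _).mpr (by rwa [L.cell_sc])) (sc L.s v)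
    ((hmem _).mpr (by rwa [L.cell_sc]))).map (E := tdom τ) (L.cell (active idx τ))
    fun a b hab => by
      rcases L.cell_step_of_sub_mem (active idx τ) hab.2.2 with he | he
      · rw [he]
      · exact .single ⟨(hmem a).mp hab.1, (hmem b).mp hab.2.1, he⟩
  rwa [L.cell_sc, L.cell_sc] at this

end Simulation

theorem exists_suitable {X : Type} [Fintype X] {N : Set Pos} (hN : IsNeighborhood N) :
    ∃ (L : Layout) (idx : Tile X N → ℤ), Suitable L idx := by
  have : Finite {w : Pos // w ∈ N} := hN.1
  obtain ⟨B, hB⟩ := (hN.1.image fun w : Pos => max |w.1| |w.2|).bddAbove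
  have hb : ∀ w ∈ N, max |w.1| |w.2| ≤ B := fun w hw => hB ⟨w, hw, rfl⟩
  let f := Finite.equivFin (Tile X N)
  refine ⟨Layout.mk' (max B 1) (Nat.card (Tile X N) + 1) (le_max_right _ _) (by omega),
    fun t => (f t : ℕ), hN, fun t t' h => ?_, fun t => Int.natCast_nonneg _, fun t => ?_,
    fun w hw => ⟨?_, ?_⟩⟩
  · exact f.injective (Fin.ext (by exact_mod_cast h))
  · have := (f t).isLt
    show ((f t : ℕ) : ℤ) < (Nat.card (Tile X N) : ℤ) + 1
    omega
  · exact (le_max_left _ _).trans ((hb w hw).trans (le_max_left _ _))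
  · exact (le_max_right _ _).trans ((hb w hw).trans (le_max_left _ _))

/-- a tiling-simulation preserving connectedness; in particular
polyominoes (finite connected tilings) are simulated by polyominoes only. -/
theorem stmt18 (X : Type) [Fintype X] (N : Set Pos) (hN : IsNeighborhood N)
    (T : Set (Tile X N)) (hT : T.Finite) :
    ∃ (Xμ : Type) (_ : Fintype Xμ) (Tμ : Set (Tile Xμ Nvn)) (_ : Tμ.Finite)
      (s : ℤ) (sim : TilingSimulation X Xμ N T Tμ s),
      (∀ τ, IsTiling T τ →
        (ConnectedDom (tdom τ) ↔
          ∀ σ ∈ sim.psi τ, ConnectedDom (tdom (induced s σ)))) ∧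
      (∀ τ, IsTiling T τ → (tdom τ).Finite → ConnectedDom (tdom τ) →
        ∀ σ ∈ sim.psi τ, (tdom (induced s σ)).Finite ∧
          ConnectedDom (tdom (induced s σ))) := by
  obtain ⟨L, idx, hL⟩ := exists_suitable (X := X) hN
  have : Finite {w : Pos // w ∈ N} := hN.1
  have : Finite {w : Pos // w ∈ Nvn} :=
    Set.Finite.to_subtype (s := Nvn) (by unfold Nvn; exact Set.toFinite _)
  refine ⟨Option (Tile X N), Fintype.ofFinite _, Set.univ, Set.finite_univ, L.s,
    hL.simulation T, fun τ hτ => ⟨fun h σ hσ => connectedDom_induced h hσ,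
      fun h => connectedDom_of_canonical (h _ (canonical_mem hτ))⟩,
    fun τ hτ hfin hconn σ hσ => ⟨?_, connectedDom_induced hconn hσ⟩⟩
  refine finite_tdom_induced (hfin.subset fun u hu => (hσ.2.1 u).mp hu) fun u σu hu => ?_
  exact (hσ.1.1 u σu hu).2

end Paper
end

section
/- Let T be a tile system in an arbitrary neighborhood N, with finite set of glues X. There exist a finite glue set X_μ, a tile system T_μ in neighborhood N_vN over X_μ, a scale s ≥ 1, a polyomino assignment φ, and a tiling-simulation ψ of T by T_μ such that for every total (T,N)-tiling τ, the set ψ(τ) contains exactly one element. -/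
namespace Paper

open scoped Classical

/-- The tiles of a macro-tile: a reference tile (`none`), and, for every `w ∈ N`, the western half
(`false`) and the eastern half (`true`) of a contact between the macro-tiles at `u` and `u + w`. -/
abbrev Slot (N : Set Pos) : Type := Option ({w : Pos // w ∈ N} × Bool)

section Slot

variable {X : Type} {N : Set Pos} {n : ℕ}

/-- The column of a slot within its block, for an enumeration `e` of the neighborhood. -/
def Slot.residue (e : {w : Pos // w ∈ N} ≃ Fin n) : Slot N → ℤ
  | none => 0
  | some (w, false) => 2 * (e w : ℕ) + 1
  | some (w, true) => 2 * (e w : ℕ) + 2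

/-- A slot of the macro-tile at `u` lies in the block at `u - offset`. -/
def Slot.offset : Slot N → Pos
  | some (w, true) => w
  | _ => 0

/-- The side length of a block. -/
def blockScale (n : ℕ) : ℤ := 2 * n + 2

/-- The position of a slot relative to the reference tile. -/
def Slot.pos (e : {w : Pos // w ∈ N} ≃ Fin n) (a : Slot N) : Pos :=
  (a.residue e, 0) - sc (blockScale n) a.offset

def Slot.east (t : Tile X N) : Slot N → Option X
  | some (w, false) => some (t w)
  | _ => none

def Slot.west (hsym : ∀ w ∈ N, -w ∈ N) (t : Tile X N) : Slot N → Option X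
  | some (w, true) => some (t ⟨-w.1, hsym _ w.2⟩)
  | _ => none

/-- The tile in slot `a` of the macro-tile for `t`: the vertical sides carry `t` itself, the
horizontal ones carry at most one glue of `t`. -/
noncomputable def Slot.cell (hsym : ∀ w ∈ N, -w ∈ N) (t : Tile X N) (a : Slot N) :
    Tile (Tile X N ⊕ Option X) Nvn := fun d =>
  if d.1 = (1, 0) then Sum.inr (a.east t)
  else if d.1 = (-1, 0) then Sum.inr (a.west hsym t)
  else Sum.inl t

/-- The macro-tile for `t`. -/
noncomputable def macroTile (e : {w : Pos // w ∈ N} ≃ Fin n) (hsym : ∀ w ∈ N, -w ∈ N)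
    (t : Tile X N) : Pos → Option (Tile (Tile X N ⊕ Option X) Nvn) := fun p =>
  if h : ∃ a : Slot N, a.pos e = p then some (h.choose.cell hsym t) else none

/-- The macro-tile for `t` occurs in `τ'` at block `u`. -/
def Fits (e : {w : Pos // w ∈ N} ≃ Fin n) (hsym : ∀ w ∈ N, -w ∈ N)
    (τ' : Pos → Option (Tile (Tile X N ⊕ Option X) Nvn)) (u : Pos) (t : Tile X N) : Prop :=
  ∀ p a, macroTile e hsym t p = some a → τ' (sc (blockScale n) u + p) = some a

/-- The partial map of the macro-tiles of `T` that occur in `τ'`. -/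
noncomputable def decode (e : {w : Pos // w ∈ N} ≃ Fin n) (hsym : ∀ w ∈ N, -w ∈ N)
    (T : Set (Tile X N)) (τ' : Pos → Option (Tile (Tile X N ⊕ Option X) Nvn)) :
    Pos → Option (Tile X N) := fun u =>
  if h : ∃ t ∈ T, Fits e hsym τ' u t then some h.choose else none

/-- Replace every tile by its macro-tile. -/
noncomputable def encode (e : {w : Pos // w ∈ N} ≃ Fin n) (hsym : ∀ w ∈ N, -w ∈ N)
    (τ : Pos → Option (Tile X N)) :
    Pos → Option (Pos → Option (Tile (Tile X N ⊕ Option X) Nvn)) := fun u =>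
  (τ u).map (macroTile e hsym)

theorem Slot.residue_nonneg (e : {w : Pos // w ∈ N} ≃ Fin n) (a : Slot N) : 0 ≤ a.residue e := by
  rcases a with _ | ⟨w, _ | _⟩ <;> simp only [Slot.residue] <;> omega

theorem Slot.residue_lt (e : {w : Pos // w ∈ N} ≃ Fin n) (a : Slot N) :
    a.residue e < blockScale n := by
  rcases a with _ | ⟨w, _ | _⟩ <;> simp only [Slot.residue, blockScale]
  · omega
  · have := (e w).2
    omega
  · have := (e w).2
    omega

theorem Slot.residue_injective (e : {w : Pos // w ∈ N} ≃ Fin n) :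
    Function.Injective (Slot.residue e) := by
  intro a b h
  rcases a with _ | ⟨w, _ | _⟩ <;> rcases b with _ | ⟨w', _ | _⟩ <;>
    simp only [Slot.residue] at h <;> first | rfl | omega | skip
  all_goals
    have h' : e w = e w' := Fin.ext (by omega)
    rw [e.injective h']

theorem eq_of_mul_add_eq {s x y r r' : ℤ} (h : s * x + r = s * y + r')
    (hr : 0 ≤ r) (hrs : r < s) (hr' : 0 ≤ r') (hrs' : r' < s) : x = y ∧ r = r' := by
  have hx : x = y := by
    rcases lt_trichotomy x y with hxy | hxy | hxy
    · nlinarith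
    · exact hxy
    · nlinarith
  subst hx
  exact ⟨rfl, by linarith⟩

theorem Slot.pos_fst (e : {w : Pos // w ∈ N} ≃ Fin n) (u : Pos) (a : Slot N) :
    (sc (blockScale n) u + a.pos e).1
      = blockScale n * (u.1 - a.offset.1) + a.residue e := by
  simp only [Slot.pos, sc, Prod.fst_add, Prod.fst_sub]
  ring

theorem Slot.pos_snd (e : {w : Pos // w ∈ N} ≃ Fin n) (u : Pos) (a : Slot N) :
    (sc (blockScale n) u + a.pos e).2 = blockScale n * (u.2 - a.offset.2) := by
  simp only [Slot.pos, sc, Prod.snd_add, Prod.snd_sub]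
  ring

theorem Slot.pos_inj (e : {w : Pos // w ∈ N} ≃ Fin n) {u v : Pos} {a b : Slot N}
    (h : sc (blockScale n) u + a.pos e = sc (blockScale n) v + b.pos e) : u = v ∧ a = b := by
  have h1 := congrArg Prod.fst h
  have h2 := congrArg Prod.snd h
  rw [Slot.pos_fst, Slot.pos_fst] at h1
  rw [Slot.pos_snd, Slot.pos_snd] at h2
  obtain ⟨h3, h4⟩ := eq_of_mul_add_eq h1 (a.residue_nonneg e) (a.residue_lt e)
    (b.residue_nonneg e) (b.residue_lt e)
  obtain rfl := Slot.residue_injective e h4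
  have hs : blockScale n ≠ 0 := by unfold blockScale; omega
  have h5 := mul_left_cancel₀ hs h2
  exact ⟨Prod.ext (by linarith) (by linarith), rfl⟩

theorem Slot.cell_injective (hsym : ∀ w ∈ N, -w ∈ N) {t t' : Tile X N} {a b : Slot N}
    (h : a.cell hsym t = b.cell hsym t') : t = t' := by
  have := congrFun h ⟨(0, 1), by simp [Nvn]⟩
  simpa [Slot.cell] using this

theorem macroTile_eq_some (e : {w : Pos // w ∈ N} ≃ Fin n) (hsym : ∀ w ∈ N, -w ∈ N)
    {t : Tile X N} {p : Pos} {c : Tile (Tile X N ⊕ Option X) Nvn} :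
    macroTile e hsym t p = some c ↔ ∃ a : Slot N, a.pos e = p ∧ a.cell hsym t = c := by
  unfold macroTile
  split_ifs with h
  · rw [Option.some_inj]
    constructor
    · exact fun hc => ⟨_, h.choose_spec, hc⟩
    · rintro ⟨a, ha, rfl⟩
      have : h.choose = a :=
        (Slot.pos_inj e (u := 0) (v := 0) (by rw [h.choose_spec, ha])).2
      rw [this]
  · simp only [false_iff]
    rintro ⟨a, ha, -⟩
    exact h ⟨a, ha⟩

theorem macroTile_ne_none (e : {w : Pos // w ∈ N} ≃ Fin n) (hsym : ∀ w ∈ N, -w ∈ N)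
    {t : Tile X N} {p : Pos} : macroTile e hsym t p ≠ none ↔ ∃ a : Slot N, a.pos e = p := by
  rw [Option.ne_none_iff_exists']
  simp only [macroTile_eq_some]
  exact ⟨fun ⟨_, a, h, _⟩ => ⟨a, h⟩, fun ⟨a, h⟩ => ⟨_, a, h, rfl⟩⟩

theorem macroTile_inj (e : {w : Pos // w ∈ N} ≃ Fin n) (hsym : ∀ w ∈ N, -w ∈ N)
    {t t' : Tile X N} {p q : Pos} {c : Tile (Tile X N ⊕ Option X) Nvn}
    (h : macroTile e hsym t p = some c) (h' : macroTile e hsym t' q = some c) : t = t' := by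
  obtain ⟨a, -, rfl⟩ := (macroTile_eq_some e hsym).1 h
  obtain ⟨b, -, h''⟩ := (macroTile_eq_some e hsym).1 h'
  exact (Slot.cell_injective hsym h'').symm

theorem macroTile_injective (e : {w : Pos // w ∈ N} ≃ Fin n) (hsym : ∀ w ∈ N, -w ∈ N) :
    Function.Injective (macroTile (X := X) e hsym) := by
  intro t t' h
  have h1 : macroTile e hsym t (Slot.pos e none) = some (Slot.cell hsym t none) :=
    (macroTile_eq_some e hsym).2 ⟨none, rfl, rfl⟩
  exact macroTile_inj e hsym h1 (h ▸ h1)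

theorem Slot.east_eq_west (e : {w : Pos // w ∈ N} ≃ Fin n) (hsym : ∀ w ∈ N, -w ∈ N)
    {t t' : Tile X N} {u u' : Pos} {a b : Slot N}
    (H : ∀ w : {w : Pos // w ∈ N}, u' = u + w.1 → t w = t' ⟨-w.1, hsym _ w.2⟩)
    (h : sc (blockScale n) u' + b.pos e = sc (blockScale n) u + a.pos e + (1, 0)) :
    a.east t = b.west hsym t' := by
  have h1 := congrArg Prod.fst h
  have h2 := congrArg Prod.snd h
  rw [Slot.pos_fst, Prod.fst_add, Slot.pos_fst] at h1
  rw [Slot.pos_snd, Prod.snd_add, Slot.pos_snd, add_zero] at h2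
  have hs : blockScale n ≠ 0 := by unfold blockScale; omega
  have h2 := mul_left_cancel₀ hs h2
  have hpar : ∀ z : ℤ, blockScale n * z = 2 * ((n + 1) * z) := fun z => by
    unfold blockScale; ring
  have hb0 := b.residue_nonneg e
  have hb1 := b.residue_lt e
  rcases a with _ | ⟨w, _ | _⟩
  · rw [hpar, hpar] at h1
    rcases b with _ | ⟨w', _ | _⟩
    · rfl
    · rfl
    · simp only [Slot.residue] at h1
      omega
  · have hw := (e w).2
    have h3 : blockScale n * (u'.1 - b.offset.1) + b.residue e =
        blockScale n * (u.1 - (0 : ℤ)) + (2 * (e w : ℕ) + 2) := by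
      have h4 : (Slot.offset (some (w, false))).1 = 0 := rfl
      have h5 : Slot.residue e (some (w, false)) = 2 * (e w : ℕ) + 1 := rfl
      rw [h4, h5] at h1
      linarith
    obtain ⟨h4, h5⟩ := eq_of_mul_add_eq h3 hb0 hb1 (by positivity) (by unfold blockScale; omega)
    have h6 : b = some (w, true) := Slot.residue_injective e h5
    subst h6
    have h7 : (Slot.offset (some (w, false))).2 = 0 := rfl
    rw [h7] at h2
    simp only [Slot.offset] at h2 h4
    simp only [Slot.east, Slot.west]
    rw [H w (Prod.ext (by rw [Prod.fst_add]; linarith) (by rw [Prod.snd_add]; linarith))]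
  · rw [hpar, hpar] at h1
    rcases b with _ | ⟨w', _ | _⟩
    · rfl
    · rfl
    · simp only [Slot.residue] at h1
      omega

theorem Slot.cell_compat (e : {w : Pos // w ∈ N} ≃ Fin n) (hsym : ∀ w ∈ N, -w ∈ N)
    {t t' : Tile X N} {u u' : Pos} {a b : Slot N}
    (H : ∀ w (hw : w ∈ N) (hw' : -w ∈ N), u' = u + w → t ⟨w, hw⟩ = t' ⟨-w, hw'⟩)
    {d : Pos} (h : sc (blockScale n) u' + b.pos e = sc (blockScale n) u + a.pos e + d)
    (hd : d ∈ Nvn) (hd' : -d ∈ Nvn) :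
    a.cell hsym t ⟨d, hd⟩ = b.cell hsym t' ⟨-d, hd'⟩ := by
  have hvert : d.2 = 1 ∨ d.2 = -1 → False := by
    intro hd2
    have h2 := congrArg Prod.snd h
    rw [Slot.pos_snd, Prod.snd_add, Slot.pos_snd] at h2
    have hpar : ∀ z : ℤ, blockScale n * z = 2 * ((n + 1) * z) := fun z => by
      unfold blockScale; ring
    rw [hpar, hpar] at h2
    omega
  have hcases := hd
  simp only [Nvn, Set.mem_insert_iff, Set.mem_singleton_iff] at hcases
  rcases hcases with rfl | rfl | rfl | rfl
  · exact (hvert (Or.inl rfl)).elim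
  · have := Slot.east_eq_west e hsym (fun w => H w.1 w.2 (hsym _ w.2)) h
    simp [Slot.cell, this]
  · exact (hvert (Or.inr rfl)).elim
  · have := Slot.east_eq_west e hsym (t := t') (t' := t) (u := u') (u' := u) (a := b) (b := a)
      (fun w hw => by
        have := H (-w.1) (hsym _ w.2) (by simp) (by rw [hw]; abel)
        rw [this]
        simp)
      (by rw [h, add_assoc]; simp)
    simp [Slot.cell, this]

theorem macroTile_isFiniteTiling (e : {w : Pos // w ∈ N} ≃ Fin n) (hsym : ∀ w ∈ N, -w ∈ N)
    (h0 : (0, 0) ∉ N) (hfin : N.Finite) (t : Tile X N) :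
    IsFiniteTiling Set.univ (macroTile e hsym t) := by
  refine ⟨⟨fun _ _ _ => Set.mem_univ _, ?_⟩, ?_⟩
  · intro p c hc d c' hc' hd hd'
    obtain ⟨a, ha, rfl⟩ := (macroTile_eq_some e hsym).1 hc
    obtain ⟨b, hb, rfl⟩ := (macroTile_eq_some e hsym).1 hc'
    refine Slot.cell_compat e hsym (u := 0) (u' := 0) ?_ (by rw [ha, hb]; abel) hd hd'
    intro w hw _ h
    rw [zero_add] at h
    subst h
    exact (h0 hw).elim
  · have : Finite {w : Pos // w ∈ N} := hfin
    refine (Set.finite_range (Slot.pos e)).subset ?_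
    intro p hp
    exact (macroTile_ne_none e hsym).1 hp

theorem encode_isPolyTiling (e : {w : Pos // w ∈ N} ≃ Fin n) (hsym : ∀ w ∈ N, -w ∈ N)
    (h0 : (0, 0) ∉ N) (hfin : N.Finite) {T : Set (Tile X N)} {τ : Pos → Option (Tile X N)}
    (hτ : IsTiling T τ) : IsPolyTiling Set.univ (blockScale n) (encode e hsym τ) := by
  simp only [IsPolyTiling, encode, Option.map_eq_some_iff]
  refine ⟨?_, ?_, ?_⟩
  · rintro u _ ⟨t, -, rfl⟩
    exact macroTile_isFiniteTiling e hsym h0 hfin t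
  · rintro u v _ _ huv ⟨t, -, rfl⟩ ⟨t', -, rfl⟩ p hp q hq heq
    obtain ⟨a, rfl⟩ := (macroTile_ne_none e hsym).1 hp
    obtain ⟨b, rfl⟩ := (macroTile_ne_none e hsym).1 hq
    exact huv (Slot.pos_inj e heq).1
  · rintro u u' _ _ ⟨t, ht, rfl⟩ ⟨t', ht', rfl⟩ p c hc q c' hc' hd hd'
    obtain ⟨a, rfl, rfl⟩ := (macroTile_eq_some e hsym).1 hc
    obtain ⟨b, rfl, rfl⟩ := (macroTile_eq_some e hsym).1 hc'
    refine Slot.cell_compat e hsym (u := u) (u' := u') ?_ (by abel) hd hd'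
    rintro w hw hw' rfl
    exact hτ.2 u t ht w t' ht' hw hw'

theorem decode_spec (e : {w : Pos // w ∈ N} ≃ Fin n) (hsym : ∀ w ∈ N, -w ∈ N)
    {T : Set (Tile X N)} {τ' : Pos → Option (Tile (Tile X N ⊕ Option X) Nvn)} {u : Pos}
    {t : Tile X N} (h : decode e hsym T τ' u = some t) : t ∈ T ∧ Fits e hsym τ' u t := by
  unfold decode at h
  split_ifs at h with hex
  obtain rfl := Option.some_inj.1 h
  exact hex.choose_spec

theorem Fits.apply_pos {e : {w : Pos // w ∈ N} ≃ Fin n} {hsym : ∀ w ∈ N, -w ∈ N}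
    {τ' : Pos → Option (Tile (Tile X N ⊕ Option X) Nvn)} {u : Pos} {t : Tile X N}
    (h : Fits e hsym τ' u t) (a : Slot N) :
    τ' (sc (blockScale n) u + a.pos e) = some (a.cell hsym t) :=
  h _ _ ((macroTile_eq_some e hsym).2 ⟨a, rfl, rfl⟩)

theorem decode_isTiling (e : {w : Pos // w ∈ N} ≃ Fin n) (hsym : ∀ w ∈ N, -w ∈ N)
    (T : Set (Tile X N)) {τ' : Pos → Option (Tile (Tile X N ⊕ Option X) Nvn)}
    (hτ' : IsTiling Set.univ τ') : IsTiling T (decode e hsym T τ') := by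
  refine ⟨fun u t h => (decode_spec e hsym h).1, ?_⟩
  intro u t ht w t' ht' hw hw'
  have h1 := (decode_spec e hsym ht).2.apply_pos (some (⟨w, hw⟩, false))
  have h2 := (decode_spec e hsym ht').2.apply_pos (some (⟨w, hw⟩, true))
  have hpos : sc (blockScale n) (u + w) + Slot.pos e (some (⟨w, hw⟩, true)) =
      sc (blockScale n) u + Slot.pos e (some (⟨w, hw⟩, false)) + (1, 0) := by
    refine Prod.ext ?_ ?_
    · rw [Slot.pos_fst, Prod.fst_add (_ + _), Slot.pos_fst]
      simp only [Slot.offset, Slot.residue, Prod.fst_add, Prod.fst_zero]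
      ring
    · rw [Slot.pos_snd, Prod.snd_add (_ + _), Slot.pos_snd]
      simp only [Slot.offset, Prod.snd_add, Prod.snd_zero]
      ring
  rw [hpos] at h2
  have h3 := hτ'.2 _ _ h1 _ _ h2 (by simp [Nvn]) (by simp [Nvn])
  simpa [Slot.cell, Slot.east, Slot.west] using h3

theorem encode_injective (e : {w : Pos // w ∈ N} ≃ Fin n) (hsym : ∀ w ∈ N, -w ∈ N) :
    Function.Injective (encode (X := X) e hsym) := by
  intro τ τ' h
  funext u
  exact Option.map_injective (macroTile_injective e hsym) (congrFun h u)

/-- The simulation of a tile system by its macro-tiles. -/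
noncomputable def macroSimulation (e : {w : Pos // w ∈ N} ≃ Fin n) (hN : IsNeighborhood N)
    (T : Set (Tile X N)) :
    TilingSimulation X (Tile X N ⊕ Option X) N T Set.univ (blockScale n) where
  hs := by unfold blockScale; omega
  phi t := {macroTile e hN.2.2 t}
  phi_fin := by
    rintro t _ rfl
    exact macroTile_isFiniteTiling e hN.2.2 hN.2.1 hN.1 t
  phi_ref := by
    rintro t _ rfl
    exact (macroTile_ne_none e hN.2.2).2 ⟨none, by simp [Slot.pos, Slot.residue, Slot.offset, sc, Prod.ext_iff]⟩
  phi_spec := by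
    rintro t t' htt' _ rfl _ rfl p q a b ha hb rfl
    exact htt' (macroTile_inj e hN.2.2 ha hb)
  chi τ' := encode e hN.2.2 (decode e hN.2.2 T τ')
  chi_poly τ' hτ' :=
    encode_isPolyTiling e hN.2.2 hN.2.1 hN.1 (decode_isTiling e hN.2.2 T hτ')
  chi_sub := by
    intro τ' u σu h
    obtain ⟨t, ht, rfl⟩ := Option.map_eq_some_iff.1 h
    obtain ⟨hT, hfit⟩ := decode_spec e hN.2.2 ht
    exact ⟨⟨t, hT, rfl⟩, hfit⟩
  chi_max := by
    rintro τ' t ht _ rfl u hfit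
    have hex : ∃ t ∈ T, Fits e hN.2.2 τ' u t := ⟨t, ht, hfit⟩
    simp [encode, decode, hex]
  psi τ := {encode e hN.2.2 τ}
  psi_nonempty _ _ := Set.singleton_nonempty _
  psi_poly := by
    rintro τ hτ _ rfl
    exact encode_isPolyTiling e hN.2.2 hN.2.1 hN.1 hτ
  psi_dom := by
    rintro τ hτ _ rfl u
    simp [encode]
  psi_comp := by
    rintro τ hτ _ rfl u t ht σu hσ
    simp only [encode, ht, Option.map_some, Option.some_inj] at hσ
    exact hσ.symm
  psi_recover τ' hτ' := by
    refine ⟨decode e hN.2.2 T τ', ⟨decode_isTiling e hN.2.2 T hτ', rfl⟩, ?_⟩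
    rintro τ ⟨-, h⟩
    exact (encode_injective e hN.2.2 h).symm

end Slot

/-- a tiling-simulation in which every total tiling is simulated by
exactly one poly-tiling. -/
theorem stmt19 (X : Type) [Fintype X] (N : Set Pos) (hN : IsNeighborhood N)
    (T : Set (Tile X N)) (hT : T.Finite) :
    ∃ (Xμ : Type) (_ : Fintype Xμ) (Tμ : Set (Tile Xμ Nvn)) (_ : Tμ.Finite)
      (s : ℤ) (sim : TilingSimulation X Xμ N T Tμ s),
      ∀ τ, IsTiling T τ → TotalDom τ → ∃! σ, σ ∈ sim.psi τ := by
  have : Finite {w : Pos // w ∈ N} := hN.1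
  have : Finite {w : Pos // w ∈ Nvn} :=
    Set.Finite.to_subtype (by unfold Nvn; exact Set.toFinite _)
  have : Finite (Tile X N) := Pi.finite
  refine ⟨Tile X N ⊕ Option X, Fintype.ofFinite _, Set.univ, Set.toFinite _, _,
    macroSimulation (Finite.equivFin {w : Pos // w ∈ N}) hN T, fun τ _ _ => ?_⟩
  exact ⟨_, rfl, fun _ h => h⟩

end Paper
end
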